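/- Let d ≥ 3 and n ≥ 4 be natural numbers, let R > 0 be a real number — work in EuclideanSpace ℝ (Fin 3). For every point c and every n points p₁,…,pₙ lying in the closed ball of radius R centered at c, the volume of their convex hull satisfies vol(convexHull ℝ {p₁,…,pₙ}) ≤ (1/6)·(n−2)·cot(ωₙ)·(3 − cot²(ωₙ))·R³, where ωₙ = (n/(n−2))·(π/6). (Right-hand side of L. Fejes Tóth's inequality (3), circumradius/vertex version.) -/

import Mathlib

open MeasureTheory Real


noncomputable def gF (w : ℝ) : ℝ := (3 * Real.cot w - Real.cot w ^ 3) / 12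

lemma hasDerivAt_cot' {w : ℝ} (h : Real.sin w ≠ 0) :
    HasDerivAt Real.cot (-(1 + Real.cot w ^ 2)) w := by
  have h1 : HasDerivAt (fun x => Real.cos x / Real.sin x)
      ((-Real.sin w * Real.sin w - Real.cos w * Real.cos w) / Real.sin w ^ 2) w :=
    (Real.hasDerivAt_cos w).div (Real.hasDerivAt_sin w) h
  have h2 : Real.cot = fun x => Real.cos x / Real.sin x := by
    funext x; exact Real.cot_eq_cos_div_sin x
  rw [h2]
  convert h1 using 1
  field_simp
  ring

lemma gF_hasDerivAt {w : ℝ} (h : Real.sin w ≠ 0) :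
    HasDerivAt gF ((Real.cot w ^ 4 - 1) / 4) w := by
  have h1 := hasDerivAt_cot' h
  have h2 := ((h1.const_mul 3).sub (h1.pow 3)).div_const 12
  refine h2.congr_deriv ?_
  push_cast
  ring

lemma cot_pos' {w : ℝ} (h0 : 0 < w) (h1 : w < π / 2) : 0 < Real.cot w := by
  rw [Real.cot_eq_cos_div_sin]
  exact div_pos (Real.cos_pos_of_mem_Ioo ⟨by linarith, h1⟩) (Real.sin_pos_of_pos_of_lt_pi h0 (by linarith))

lemma sin_pos' {w : ℝ} (h0 : 0 < w) (h1 : w < π / 2) : 0 < Real.sin w :=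
  Real.sin_pos_of_pos_of_lt_pi h0 (by linarith)

lemma cot_anti : AntitoneOn Real.cot (Set.Ioo 0 (π / 2)) := by
  apply antitoneOn_of_deriv_nonpos (convex_Ioo _ _)
  · intro w hw
    exact (hasDerivAt_cot' (sin_pos' hw.1 hw.2).ne').continuousAt.continuousWithinAt
  · intro w hw
    rw [interior_Ioo] at hw
    exact (hasDerivAt_cot' (sin_pos' hw.1 hw.2).ne').differentiableAt.differentiableWithinAt
  · intro w hw
    rw [interior_Ioo] at hw
    rw [(hasDerivAt_cot' (sin_pos' hw.1 hw.2).ne').deriv]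
    nlinarith [sq_nonneg (Real.cot w)]

lemma gF_concave : ConcaveOn ℝ (Set.Ioo 0 (π / 2)) gF := by
  apply AntitoneOn.concaveOn_of_deriv (convex_Ioo _ _)
  · intro w hw
    exact (gF_hasDerivAt (sin_pos' hw.1 hw.2).ne').continuousAt.continuousWithinAt
  · intro w hw
    rw [interior_Ioo] at hw
    exact (gF_hasDerivAt (sin_pos' hw.1 hw.2).ne').differentiableAt.differentiableWithinAt
  · rw [interior_Ioo]
    intro w hw u hu hwu
    rw [(gF_hasDerivAt (sin_pos' hw.1 hw.2).ne').deriv, (gF_hasDerivAt (sin_pos' hu.1 hu.2).ne').deriv]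
    have h1 := cot_anti hw hu hwu
    have h2 := cot_pos' hu.1 hu.2
    have : Real.cot u ^ 4 ≤ Real.cot w ^ 4 := by gcongr
    linarith

lemma gF_pi_six : gF (π / 6) = 0 := by
  unfold gF
  rw [Real.cot_eq_cos_div_sin, Real.cos_pi_div_six, Real.sin_pi_div_six]
  have : (√3) ^ 2 = 3 := Real.sq_sqrt (by norm_num)
  have h3 : (√3) ^ 3 = 3 * √3 := by rw [pow_succ, this]
  field_simp
  rw [this]; norm_num

lemma omega_eq (n : ℕ) (hn : 4 ≤ n) : π / 6 + (2 * π / 3) * (1 / (2 * (n:ℝ) - 4)) = ((n : ℝ) / ((n : ℝ) - 2)) * (π / 6) := by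
  have : (4:ℝ) ≤ n := by exact_mod_cast hn
  have h : (n:ℝ) - 2 ≠ 0 := by linarith
  have h' : 2 * (n:ℝ) - 4 = 2 * (n - 2) := by ring
  rw [h']
  field_simp
  ring

lemma gF_jensen {ι : Type*} (s : Finset ι) (v : ι → ℝ) (b : ℝ) (n : ℕ) (hn : 4 ≤ n) (hb : 0 < b)
    (hv : ∀ i ∈ s, 0 < v i ∧ v i < b / 2) (hsum : ∑ i ∈ s, v i = b)
    (hcard : (s.card : ℝ) ≤ 2 * n - 4) :
    ∑ i ∈ s, gF (π / 6 + (2 * π / 3) * (v i / b)) ≤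
      (2 * (n:ℝ) - 4) * gF (((n : ℝ) / ((n : ℝ) - 2)) * (π / 6)) := by
  have hn' : (4:ℝ) ≤ n := by exact_mod_cast hn
  have hpi := Real.pi_pos
  have hs0 : 0 < (s.card : ℝ) := by
    have : s.Nonempty := by
      by_contra h
      rw [Finset.not_nonempty_iff_eq_empty] at h
      rw [h] at hsum; simp at hsum; linarith
    exact_mod_cast this.card_pos
  have hcard2 : 2 < (s.card : ℝ) := by
    have h1 : ∑ i ∈ s, v i < ∑ i ∈ s, b / 2 := by
      apply Finset.sum_lt_sum_of_nonempty
      · exact Finset.card_pos.mp (by exact_mod_cast hs0)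
      · intro i hi; exact (hv i hi).2
    rw [hsum] at h1
    simp at h1
    nlinarith
  have hmem : ∀ i ∈ s, π / 6 + (2 * π / 3) * (v i / b) ∈ Set.Ioo 0 (π / 2) := by
    intro i hi
    obtain ⟨h1, h2⟩ := hv i hi
    have h3 : 0 < v i / b := by positivity
    have h4 : v i / b < 1 / 2 := by rw [div_lt_iff₀ hb]; linarith
    constructor
    · positivity
    · nlinarith
  obtain ⟨m, hm⟩ : ∃ m : ℝ, m = s.card := ⟨_, rfl⟩
  rw [← hm] at hs0 hcard2 hcard
  have J := gF_concave.le_map_sum (t := s) (w := fun _ => 1 / m) (p := fun i => π / 6 + (2 * π / 3) * (v i / b))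
    (fun _ _ => by positivity) (by simp [← hm]; field_simp) hmem
  simp only [smul_eq_mul] at J
  rw [← Finset.mul_sum, ← Finset.mul_sum, Finset.sum_add_distrib, ← Finset.mul_sum, ← Finset.sum_div s v b, hsum] at J
  simp only [Finset.sum_const, nsmul_eq_mul, ← hm] at J
  have e1 : 1 / m * (m * (π / 6) + 2 * π / 3 * (b / b)) = π / 6 + (2 * π / 3) * (1 / m) := by
    field_simp
  rw [e1] at J
  have hM : 0 < 2 * (n:ℝ) - 4 := by linarith
  have hx1 : π / 6 + (2 * π / 3) * (1 / m) ∈ Set.Ioo 0 (π / 2) := by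
    have h3 : 0 < 1 / m := by positivity
    have h4 : 1 / m < 1 / 2 := by rw [div_lt_div_iff₀ hs0 two_pos]; linarith
    constructor
    · positivity
    · nlinarith
  have hx2 : π / 6 ∈ Set.Ioo 0 (π / 2) := ⟨by positivity, by linarith⟩
  have ha : 0 ≤ m / (2 * (n:ℝ) - 4) := by positivity
  have hb' : 0 ≤ 1 - m / (2 * (n:ℝ) - 4) := by rw [sub_nonneg, div_le_one hM]; exact hcard
  have K := gF_concave.2 hx1 hx2 ha hb' (by ring)
  simp only [smul_eq_mul, gF_pi_six, mul_zero, add_zero] at K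
  have e2 : m / (2 * (n:ℝ) - 4) * (π / 6 + 2 * π / 3 * (1 / m)) + (1 - m / (2 * (n:ℝ) - 4)) * (π / 6)
      = π / 6 + (2 * π / 3) * (1 / (2 * (n:ℝ) - 4)) := by
    field_simp
    ring
  rw [e2, omega_eq n hn] at K
  rw [div_mul_eq_mul_div, div_le_iff₀ hM] at K
  rw [div_mul_eq_mul_div, one_mul, div_le_iff₀ hs0] at J
  linarith

lemma gF_omega_nonneg (n : ℕ) (hn : 4 ≤ n) : 0 ≤ gF (((n : ℝ) / ((n : ℝ) - 2)) * (π / 6)) := by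
  have hn' : (4:ℝ) ≤ n := by exact_mod_cast hn
  have hpi := Real.pi_pos
  rw [← omega_eq n hn]
  set w := π / 6 + (2 * π / 3) * (1 / (2 * (n:ℝ) - 4))
  have hM : 0 < 2 * (n:ℝ) - 4 := by linarith
  have h0 : 0 < 1 / (2 * (n:ℝ) - 4) := by positivity
  have h4 : 1 / (2 * (n:ℝ) - 4) ≤ 1 / 4 := by rw [div_le_div_iff₀ hM (by norm_num)]; linarith
  have hw1 : π / 6 ≤ w := by simp only [w]; nlinarith
  have hw2 : w < π / 2 := by simp only [w]; nlinarith
  have h1 := cot_anti (a := π / 6) (b := w) ⟨by positivity, by linarith⟩ ⟨by linarith, hw2⟩ hw1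
  have h2 := cot_pos' (w := w) (by linarith) hw2
  have h3 : Real.cot (π / 6) = √3 := by
    rw [Real.cot_eq_cos_div_sin, Real.cos_pi_div_six, Real.sin_pi_div_six]; field_simp
  rw [h3] at h1
  have : (√3) ^ 2 = 3 := Real.sq_sqrt (by norm_num)
  have h5 : Real.cot w ^ 2 ≤ 3 := by rw [← this]; gcongr
  unfold gF
  have : 3 * Real.cot w - Real.cot w ^ 3 = Real.cot w * (3 - Real.cot w ^ 2) := by ring
  rw [this]
  have : 0 ≤ 3 - Real.cot w ^ 2 := by linarith
  positivity

lemma gram_le {x y z : ℝ} (hx : x ≤ 1) (hy : y ≤ 1) (hz : z ≤ 1) (hs : 0 ≤ 3 + 2 * (x + y + z)) :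
    1 + 2 * x * y * z - x ^ 2 - y ^ 2 - z ^ 2 ≤
      (1 - (x + y + z) / 3) ^ 2 * (1 + 2 * ((x + y + z) / 3)) := by
  obtain ⟨q, hq⟩ : ∃ q, q = (x + y + z) / 3 := ⟨_, rfl⟩
  obtain ⟨u, hu⟩ : ∃ u, u = x - q := ⟨_, rfl⟩
  obtain ⟨v, hv⟩ : ∃ v, v = y - q := ⟨_, rfl⟩
  obtain ⟨w, hw⟩ : ∃ w, w = z - q := ⟨_, rfl⟩
  have hx' : x = q + u := by linarith
  have hy' : y = q + v := by linarith
  have hz' : z = q - u - v := by linarith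
  rw [← hq]
  have hwz : w = - u - v := by linarith
  have key : ∀ u v w : ℝ, u + v + w = 0 → u ≤ 3 * (1 + q) → v ≤ 3 * (1 + q) → w ≤ 3 * (1 + q) → 0 ≤ 1 + q →
      2 * (u * v * w) ≤ (u ^ 2 + v ^ 2 + w ^ 2) * (1 + q) := by
    have aux : ∀ u v w : ℝ, u + v + w = 0 → u ≤ 3 * (1 + q) → 0 ≤ 1 + q → 0 ≤ u →
      2 * (u * v * w) ≤ (u ^ 2 + v ^ 2 + w ^ 2) * (1 + q) := by
      intro u v w h0 h1 h2 h3
      have hw : w = - u - v := by linarith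
      subst hw
      have e1 : v * (-u - v) ≤ u ^ 2 / 4 := by nlinarith [sq_nonneg (u + 2 * v)]
      have e2 : 3 / 2 * u ^ 2 ≤ u ^ 2 + v ^ 2 + (-u - v) ^ 2 := by nlinarith [sq_nonneg (u + 2 * v)]
      calc 2 * (u * v * (-u - v)) = 2 * u * (v * (-u - v)) := by ring
        _ ≤ 2 * u * (u ^ 2 / 4) := by gcongr
        _ = u ^ 2 / 2 * u := by ring
        _ ≤ u ^ 2 / 2 * (3 * (1 + q)) := by gcongr
        _ = (3 / 2 * u ^ 2) * (1 + q) := by ring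
        _ ≤ _ := by gcongr
    intro u v w h0 h1 h2 h3 h4
    by_cases hu : 0 ≤ u
    · exact aux u v w h0 h1 h4 hu
    by_cases hv : 0 ≤ v
    · have := aux v u w (by linarith) h2 h4 hv
      linarith
    · have := aux w u v (by linarith) h3 h4 (by push Not at hu hv; linarith)
      linarith
  have h1 : 0 ≤ 1 + 2 * q := by linarith
  have := key u v w (by linarith) (by linarith) (by linarith) (by linarith) (by linarith)
  rw [hwz] at this
  rw [hx', hy', hz']
  nlinarith

lemma bracket_pos {A k : ℝ} (hk : 0 < k) (hA8 : A < 8) (hB4 : k * A ≤ 4)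
    (hBl : -1 / 2 < k * A) : 0 < -A ^ 3 * k ^ 2 + 24 * k * A + 32 * k + 16 := by
  obtain ⟨B, hB⟩ : ∃ B, B = k * A := ⟨_, rfl⟩
  rw [← hB] at hB4 hBl
  have e : -A ^ 3 * k ^ 2 + 24 * k * A + 32 * k + 16 = - A * B ^ 2 + 24 * B + 32 * k + 16 := by
    rw [hB]; ring
  rw [e]
  rcases le_or_gt A 0 with hA0 | hA0
  · have := mul_nonneg (neg_nonneg.mpr hA0) (sq_nonneg B)
    linarith
  · have hB0 : 0 < B := by rw [hB]; positivity
    have e2 : A * (- A * B ^ 2 + 24 * B + 32 * k + 16) =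
        A ^ 2 * (B * (4 - B)) + 4 * ((4 - B) * A) + 4 * (B * ((8 - A) * (A + 1))) := by
      rw [hB]; ring
    have h4 : 0 ≤ 4 - B := by linarith
    have h8 : 0 < 8 - A := by linarith
    have : 0 < A * (- A * B ^ 2 + 24 * B + 32 * k + 16) := by
      rw [e2]; positivity
    exact pos_of_mul_pos_right this hA0.le

lemma trig_bound {s D th r : ℝ} (hth0 : 0 < th) (hth1 : th < π) (hr : 0 < r)
    (h1 : 1 + s = r * Real.cos th) (h2 : D = r * Real.sin th) (hs3 : s ≤ 3)
    (h3 : D ^ 2 ≤ (1 - s / 3) ^ 2 * (1 + 2 * (s / 3))) :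
    D / 6 ≤ gF (π / 6 + th / 3) := by
  set w := π / 6 + th / 3 with hw
  have hpi := Real.pi_pos
  have hw0 : π / 6 < w := by linarith
  have hw1 : w < π / 2 := by linarith
  have hsin := sin_pos' (w := w) (by linarith) hw1
  have ht := cot_pos' (w := w) (by linarith) hw1
  have hcos : Real.cos w = Real.cot w * Real.sin w := by
    rw [Real.cot_eq_cos_div_sin]; field_simp
  have hthw : th = 3 * w - π / 2 := by rw [hw]; ring
  set t := Real.cot w with htdef
  have hsc : Real.sin w ^ 2 * (1 + t ^ 2) = 1 := by
    have := Real.sin_sq_add_cos_sq w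
    rw [hcos] at this; linarith
  have c1 : Real.cos th = Real.sin w ^ 3 * (3 * t ^ 2 - 1) := by
    rw [hthw, Real.cos_sub_pi_div_two, Real.sin_three_mul]
    linear_combination (-3 * Real.sin w) * hsc
  have c2 : Real.sin th = Real.sin w ^ 3 * (3 * t - t ^ 3) := by
    rw [hthw, Real.sin_sub_pi_div_two, Real.cos_three_mul, hcos]
    linear_combination (-3 * t * Real.sin w) * hsc
  have ht3 : t ^ 2 < 3 := by
    have : 0 < Real.sin th := Real.sin_pos_of_pos_of_lt_pi hth0 hth1
    rw [c2] at this
    have h := pos_of_mul_pos_right this (by positivity)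
    have : 0 < t * (3 - t ^ 2) := by linarith
    have := pos_of_mul_pos_right this ht.le
    linarith
  set k := r * Real.sin w ^ 3 with hk
  have hkpos : 0 < k := by positivity
  have h1' : 1 + s = k * (3 * t ^ 2 - 1) := by rw [h1, c1]; ring
  have h2' : D = k * (3 * t - t ^ 3) := by rw [h2, c2]; ring
  have hDpos : 0 < D := by rw [h2]; exact mul_pos hr (Real.sin_pos_of_pos_of_lt_pi hth0 hth1)
  have hq : 0 < 1 + 2 * (s / 3) := by
    by_contra hneg
    push Not at hneg
    have : (1 - s / 3) ^ 2 * (1 + 2 * (s / 3)) ≤ 0 := mul_nonpos_of_nonneg_of_nonpos (sq_nonneg _) hneg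
    nlinarith [pow_pos hDpos 2]
  have hkle : k ≤ 1 / 2 := by
    by_contra hcon
    push Not at hcon
    obtain ⟨A, hA⟩ : ∃ A, A = 3 * t ^ 2 - 1 := ⟨_, rfl⟩
    have hA1 : -1 < A := by rw [hA]; nlinarith [pow_pos ht 2]
    have hA8 : A < 8 := by rw [hA]; linarith
    have hs : s = k * A - 1 := by rw [hA]; linarith
    have hD2 : D ^ 2 = k ^ 2 * ((A + 1) * (8 - A) ^ 2) / 27 := by
      rw [h2', hA]; ring
    rw [hD2, hs] at h3
    have h3' : (2 * k - 1) * (-A ^ 3 * k ^ 2 + 24 * k * A + 32 * k + 16) ≤ 0 := by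
      have e0 : (2 * k - 1) * (-A ^ 3 * k ^ 2 + 24 * k * A + 32 * k + 16) =
        27 * (k ^ 2 * ((A + 1) * (8 - A) ^ 2) / 27 -
          (1 - (k * A - 1) / 3) ^ 2 * (1 + 2 * ((k * A - 1) / 3))) := by ring
      rw [e0]; linarith
    have hbr := bracket_pos (A := A) (k := k) hkpos hA8 (by linarith) (by rw [hs] at hq; linarith)
    have : 0 < (2 * k - 1) * (-A ^ 3 * k ^ 2 + 24 * k * A + 32 * k + 16) := mul_pos (by linarith) hbr
    linarith
  unfold gF
  rw [← htdef, h2']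
  have : 0 ≤ 3 * t - t ^ 3 := by
    have : 3 * t - t ^ 3 = t * (3 - t ^ 2) := by ring
    rw [this]; have : 0 ≤ 3 - t ^ 2 := by linarith
    positivity
  nlinarith

/-- angle-excess identity -/
lemma angle_identity {x y z D : ℝ} (hD : 0 < D) (hx : x ^ 2 < 1) (hy : y ^ 2 < 1) (hz : z ^ 2 < 1)
    (hG : D ^ 2 = 1 + 2 * x * y * z - x ^ 2 - y ^ 2 - z ^ 2)
    (h0 : 0 < Complex.arg ⟨x - y * z, D⟩ + Complex.arg ⟨y - z * x, D⟩ + Complex.arg ⟨z - x * y, D⟩ - π)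
    (h1 : Complex.arg ⟨x - y * z, D⟩ + Complex.arg ⟨y - z * x, D⟩ + Complex.arg ⟨z - x * y, D⟩ - π < 2 * π) :
    Complex.arg ⟨x - y * z, D⟩ + Complex.arg ⟨y - z * x, D⟩ + Complex.arg ⟨z - x * y, D⟩ - π =
      2 * Complex.arg ⟨1 + (x + y + z), D⟩ := by
  have hne : ∀ r : ℝ, (⟨r, D⟩ : ℂ) ≠ 0 := by
    intro r h; have := congrArg Complex.im h; simp at this; linarith
  have hpol : ∀ r : ℝ, (⟨r, D⟩ : ℂ) = ‖(⟨r, D⟩ : ℂ)‖ * Complex.exp (Complex.arg ⟨r, D⟩ * Complex.I) :=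
    fun r => (Complex.norm_mul_exp_arg_mul_I _).symm
  have harg : ∀ r : ℝ, 0 < Complex.arg ⟨r, D⟩ ∧ Complex.arg ⟨r, D⟩ < π := by
    intro r
    constructor
    · refine lt_of_le_of_ne (Complex.arg_nonneg_iff.mpr hD.le) ?_
      intro h
      have := (Complex.arg_eq_zero_iff.mp h.symm).2
      simp at this; linarith
    · exact Complex.arg_lt_pi_iff.mpr (Or.inr hD.ne')
  set α := Complex.arg ⟨x - y * z, D⟩
  set β := Complex.arg ⟨y - z * x, D⟩
  set γ := Complex.arg ⟨z - x * y, D⟩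
  set ψ := Complex.arg ⟨1 + (x + y + z), D⟩
  have hprod : (⟨x - y * z, D⟩ : ℂ) * ⟨y - z * x, D⟩ * ⟨z - x * y, D⟩ =
      -(((1 - x) * (1 - y) * (1 - z) / 2 : ℝ) : ℂ) * (⟨1 + (x + y + z), D⟩ : ℂ) ^ 2 := by
    apply Complex.ext
    · simp [pow_two]
      ring_nf
      have hG3 : D ^ 2 = 1 + 2 * x * y * z - x ^ 2 - y ^ 2 - z ^ 2 := hG
      simp only [hG3]
      ring
    · simp [pow_two]
      have hG3 : D ^ 3 = (1 + 2 * x * y * z - x ^ 2 - y ^ 2 - z ^ 2) * D := by rw [← hG]; ring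
      ring_nf
      simp only [hG3]
      ring
  have hc : 0 < (1 - x) * (1 - y) * (1 - z) / 2 := by
    have : x < 1 := by nlinarith
    have : y < 1 := by nlinarith
    have : z < 1 := by nlinarith
    have : 0 < 1 - x := by linarith
    have : 0 < 1 - y := by linarith
    have : 0 < 1 - z := by linarith
    positivity
  set k := (1 - x) * (1 - y) * (1 - z) / 2
  have hexp : Complex.exp ((α + β + γ - π - 2 * ψ : ℝ) * Complex.I) = 1 := by
    rw [hpol (x - y * z), hpol (y - z * x), hpol (z - x * y), hpol (1 + (x + y + z))] at hprod
    have e1 : Complex.exp ((α + β + γ - π - 2 * ψ : ℝ) * Complex.I) * Complex.exp (π * Complex.I) * Complex.exp (ψ * Complex.I) ^ 2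
        = Complex.exp (α * Complex.I) * Complex.exp (β * Complex.I) * Complex.exp (γ * Complex.I) := by
      rw [← Complex.exp_nat_mul, ← Complex.exp_add, ← Complex.exp_add, ← Complex.exp_add, ← Complex.exp_add]
      congr 1
      push_cast
      ring
    rw [Complex.exp_pi_mul_I] at e1
    have hn := congrArg norm hprod
    simp only [norm_mul, norm_neg, norm_pow, Complex.norm_exp_ofReal_mul_I, mul_one, Complex.norm_real, norm_norm, Real.norm_of_nonneg hc.le] at hn
    have hn' : (‖(⟨x - y * z, D⟩ : ℂ)‖ : ℂ) * ‖(⟨y - z * x, D⟩ : ℂ)‖ * ‖(⟨z - x * y, D⟩ : ℂ)‖ = k * ‖(⟨1 + (x + y + z), D⟩ : ℂ)‖ ^ 2 := by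
      exact_mod_cast hn
    have hk0 : (k : ℂ) * ‖(⟨1 + (x + y + z), D⟩ : ℂ)‖ ^ 2 ≠ 0 := by
      have : ‖(⟨1 + (x + y + z), D⟩ : ℂ)‖ ≠ 0 := norm_ne_zero_iff.mpr (hne _)
      have h := mul_ne_zero hc.ne' (pow_ne_zero 2 this)
      exact_mod_cast h
    have e2 : (k : ℂ) * ‖(⟨1 + (x + y + z), D⟩ : ℂ)‖ ^ 2 * (Complex.exp (α * Complex.I) * Complex.exp (β * Complex.I) * Complex.exp (γ * Complex.I))
       = (k : ℂ) * ‖(⟨1 + (x + y + z), D⟩ : ℂ)‖ ^ 2 * (- Complex.exp (ψ * Complex.I) ^ 2) := by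
      linear_combination hprod - (Complex.exp (α * Complex.I) * Complex.exp (β * Complex.I) * Complex.exp (γ * Complex.I)) * hn'
    have e3 := mul_left_cancel₀ hk0 e2
    rw [e3] at e1
    have hne2 : Complex.exp (ψ * Complex.I) ^ 2 ≠ 0 := pow_ne_zero 2 (Complex.exp_ne_zero _)
    apply mul_right_cancel₀ hne2
    linear_combination - e1
  rw [Complex.exp_eq_one_iff] at hexp
  obtain ⟨m, hm⟩ := hexp
  have hm' : α + β + γ - π - 2 * ψ = m * (2 * π) := by
    have : ((α + β + γ - π - 2 * ψ : ℝ) : ℂ) * Complex.I = ((m * (2 * π) : ℝ) : ℂ) * Complex.I := by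
      rw [hm]; push_cast; ring
    have := mul_right_cancel₀ Complex.I_ne_zero this
    exact_mod_cast this
  have hψ := harg (1 + (x + y + z))
  have hpi := Real.pi_pos
  have hm0 : m = 0 := by
    have a1 : (m:ℝ) < 1 := by
      by_contra h; push Not at h; nlinarith [hψ.1, hψ.2]
    have a2 : (-1:ℝ) < m := by
      by_contra h; push Not at h; nlinarith [hψ.1, hψ.2]
    have : m < 1 := by exact_mod_cast a1
    have : -1 < m := by exact_mod_cast a2
    omega
  rw [hm0] at hm'
  simp at hm'
  linarith


abbrev E3 := EuclideanSpace ℝ (Fin 3)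

def coordMap (x : E3) : ℝ × (ℝ × ℝ) := (x 2, (x 0, x 1))

lemma coordMap_mp : MeasurePreserving coordMap volume volume := by
  have h1 := PiLp.volume_preserving_ofLp (Fin 3)
  have h2 := volume_preserving_piFinSuccAbove (fun _ : Fin 3 => ℝ) 2
  have h3 := (MeasurePreserving.id (volume : Measure ℝ)).prod (volume_preserving_finTwoArrow ℝ)
  have h := h3.comp (h2.comp h1)
  have hc : coordMap = (Prod.map id ⇑(MeasurableEquiv.finTwoArrow (α := ℝ)) ∘
      ⇑(MeasurableEquiv.piFinSuccAbove (fun _ : Fin 3 => ℝ) 2) ∘ WithLp.ofLp) := by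
    funext x
    rfl
  rw [hc]
  exact h

lemma sector2 (c α : ℝ) (h0 : 0 < α) (h1 : α < π) :
    ENNReal.ofReal (2 * π) * volume {p : ℝ × ℝ | p.1 ^ 2 + p.2 ^ 2 ≤ c ∧ 0 < p.2 ∧ 0 < p.1 * Real.sin α - p.2 * Real.cos α} =
      ENNReal.ofReal α * volume {p : ℝ × ℝ | p.1 ^ 2 + p.2 ^ 2 ≤ c} := by
  have hm1 : MeasurableSet {p : ℝ × ℝ | p.1 ^ 2 + p.2 ^ 2 ≤ c} := by measurability
  have hm2 : MeasurableSet {p : ℝ × ℝ | p.1 ^ 2 + p.2 ^ 2 ≤ c ∧ 0 < p.2 ∧ 0 < p.1 * Real.sin α - p.2 * Real.cos α} := by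
    measurability
  set f : ℝ → ENNReal := fun r => ENNReal.ofReal r * (Set.indicator {r : ℝ | r ^ 2 ≤ c} 1 r) with hf
  have hfm : Measurable f := by
    apply Measurable.mul (by fun_prop)
    apply measurable_one.indicator
    measurability
  have key : ∀ (A : Set (ℝ × ℝ)) (T : Set ℝ), MeasurableSet A → MeasurableSet T → T ⊆ Set.Ioo (-π) π →
      (∀ r θ : ℝ, 0 < r → θ ∈ Set.Ioo (-π) π → ((r * Real.cos θ, r * Real.sin θ) ∈ A ↔ r ^ 2 ≤ c ∧ θ ∈ T)) →
      volume A = (∫⁻ r in Set.Ioi 0, f r) * volume T := by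
    intro A T hA hT hTs h
    rw [← lintegral_indicator_one hA, ← lintegral_comp_polarCoord_symm]
    have e : ∀ p ∈ polarCoord.target, ENNReal.ofReal p.1 • (A.indicator (1 : ℝ × ℝ → ENNReal) (polarCoord.symm p)) =
        f p.1 * T.indicator 1 p.2 := by
      rintro ⟨r, θ⟩ hp
      rw [polarCoord_target] at hp
      have := h r θ hp.1 hp.2
      rw [polarCoord_symm_apply]
      simp only [hf, smul_eq_mul, mul_assoc]
      congr 1
      by_cases hr : r ^ 2 ≤ c <;> by_cases ht : θ ∈ T <;> simp [Set.indicator, this, hr, ht]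
    rw [setLIntegral_congr_fun polarCoord.open_target.measurableSet e, polarCoord_target,
      Measure.volume_eq_prod, ← Measure.prod_restrict,
      lintegral_prod_mul hfm.aemeasurable (by exact (measurable_one.indicator hT).aemeasurable)]
    congr 1
    rw [lintegral_indicator_one hT, Measure.restrict_apply hT, Set.inter_eq_left.mpr hTs]
  rw [key _ (Set.Ioo 0 α) hm2 measurableSet_Ioo ?_ ?_, key _ (Set.Ioo (-π) π) hm1 measurableSet_Ioo le_rfl ?_]
  · simp only [Real.volume_Ioo]
    rw [show π - -π = 2 * π by ring, sub_zero]
    ring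
  · intro r θ hr ht
    simp only [Set.mem_ofPred_eq]
    have : (r * Real.cos θ) ^ 2 + (r * Real.sin θ) ^ 2 = r ^ 2 := by
      linear_combination r ^ 2 * Real.sin_sq_add_cos_sq θ
    rw [this]; simp only [ht, and_true]
  · intro t ht; exact ⟨by linarith [ht.1, Real.pi_pos], by linarith [ht.2]⟩
  · intro r θ hr ht
    simp only [Set.mem_ofPred_eq]
    have : (r * Real.cos θ) ^ 2 + (r * Real.sin θ) ^ 2 = r ^ 2 := by
      linear_combination r ^ 2 * Real.sin_sq_add_cos_sq θ
    rw [this]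
    have e : r * Real.cos θ * Real.sin α - r * Real.sin θ * Real.cos α = r * Real.sin (α - θ) := by
      rw [Real.sin_sub]; ring
    rw [e]
    apply and_congr_right
    intro _
    constructor
    · rintro ⟨a, b⟩
      have a' := pos_of_mul_pos_right a hr.le
      have b' := pos_of_mul_pos_right b hr.le
      have ht0 : 0 < θ := by
        by_contra hcon
        push Not at hcon
        have := Real.sin_nonpos_of_nonpos_of_neg_pi_le hcon ht.1.le
        linarith
      refine ⟨ht0, ?_⟩
      by_contra hcon
      push Not at hcon
      have := Real.sin_nonpos_of_nonpos_of_neg_pi_le (x := α - θ) (by linarith) (by linarith [ht.2])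
      linarith
    · rintro ⟨a, b⟩
      exact ⟨mul_pos hr (Real.sin_pos_of_pos_of_lt_pi a (by linarith)),
        mul_pos hr (Real.sin_pos_of_pos_of_lt_pi (by linarith) (by linarith))⟩

lemma mem_ball_iff (x : E3) : x ∈ Metric.closedBall (0 : E3) 1 ↔ x 0 ^ 2 + x 1 ^ 2 + x 2 ^ 2 ≤ 1 := by
  rw [mem_closedBall_zero_iff, EuclideanSpace.norm_eq, Real.sqrt_le_one]
  simp [Fin.sum_univ_three]

lemma sector3 (α : ℝ) (h0 : 0 < α) (h1 : α < π) :
    ENNReal.ofReal (2 * π) * volume {x : E3 | x ∈ Metric.closedBall (0 : E3) 1 ∧ 0 < x 1 ∧ 0 < x 0 * Real.sin α - x 1 * Real.cos α} =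
      ENNReal.ofReal α * volume (Metric.closedBall (0 : E3) 1) := by
  have e1 : {x : E3 | x ∈ Metric.closedBall (0 : E3) 1 ∧ 0 < x 1 ∧ 0 < x 0 * Real.sin α - x 1 * Real.cos α} =
      coordMap ⁻¹' {q | q.2.1 ^ 2 + q.2.2 ^ 2 ≤ 1 - q.1 ^ 2 ∧ 0 < q.2.2 ∧ 0 < q.2.1 * Real.sin α - q.2.2 * Real.cos α} := by
    ext x
    rw [Set.mem_ofPred_eq, mem_ball_iff]
    simp only [coordMap, Set.mem_preimage, Set.mem_ofPred_eq]
    rw [le_sub_iff_add_le]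
  have e2 : Metric.closedBall (0 : E3) 1 =
      coordMap ⁻¹' {q | q.2.1 ^ 2 + q.2.2 ^ 2 ≤ 1 - q.1 ^ 2} := by
    ext x
    rw [mem_ball_iff]
    simp only [coordMap, Set.mem_preimage, Set.mem_ofPred_eq]
    rw [le_sub_iff_add_le]
  have hm1 : MeasurableSet {q : ℝ × ℝ × ℝ | q.2.1 ^ 2 + q.2.2 ^ 2 ≤ 1 - q.1 ^ 2} := 
    measurableSet_le (by fun_prop) (by fun_prop)
  have hm2 : MeasurableSet {q : ℝ × ℝ × ℝ | q.2.1 ^ 2 + q.2.2 ^ 2 ≤ 1 - q.1 ^ 2 ∧ 0 < q.2.2 ∧ 0 < q.2.1 * Real.sin α - q.2.2 * Real.cos α} :=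
    by
    refine MeasurableSet.inter hm1 (MeasurableSet.inter (s₁ := {q : ℝ × ℝ × ℝ | 0 < q.2.2})
      (s₂ := {q : ℝ × ℝ × ℝ | 0 < q.2.1 * Real.sin α - q.2.2 * Real.cos α}) ?_ ?_)
    · exact measurableSet_lt (by fun_prop) (by fun_prop)
    · exact measurableSet_lt (by fun_prop) (by fun_prop)
  rw [e1, e2, coordMap_mp.measure_preimage hm1.nullMeasurableSet,
    coordMap_mp.measure_preimage hm2.nullMeasurableSet, Measure.volume_eq_prod,
    Measure.prod_apply hm1, Measure.prod_apply hm2, ← lintegral_const_mul _ (measurable_measure_prodMk_left hm1),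
    ← lintegral_const_mul _ (measurable_measure_prodMk_left hm2)]
  apply lintegral_congr
  intro z
  exact sector2 (1 - z ^ 2) α h0 h1


def dt (a b c : E3) : ℝ :=
  a 0 * (b 1 * c 2 - b 2 * c 1) - a 1 * (b 0 * c 2 - b 2 * c 0) + a 2 * (b 0 * c 1 - b 1 * c 0)

lemma inner3 (a b : E3) : inner ℝ a b = a 0 * b 0 + a 1 * b 1 + a 2 * b 2 := by
  simp [PiLp.inner_apply, Fin.sum_univ_three]
  ring

lemma gram3 (a b c : E3) : dt a b c ^ 2 =
    inner ℝ a a * inner ℝ b b * inner ℝ c c + 2 * inner ℝ b c * inner ℝ c a * inner ℝ a b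
      - inner ℝ a a * inner ℝ b c ^ 2 - inner ℝ b b * inner ℝ c a ^ 2 - inner ℝ c c * inner ℝ a b ^ 2 := by
  simp only [inner3, dt]
  ring

def wedge3 (a b c : E3) : Set E3 := {x | ∃ l m n : ℝ, 0 < m ∧ 0 < n ∧ x = l • a + m • b + n • c}

def cone3 (a b c : E3) : Set E3 :=
  {x | ∃ l m n : ℝ, 0 < l ∧ 0 < m ∧ 0 < n ∧ x = l • a + m • b + n • c}

lemma wedge_sector (B : OrthonormalBasis (Fin 3) ℝ E3) (a b c : E3) (z y β κ α : ℝ)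
    (ha : a = B 2) (hb : b = z • B 2 + β • B 0)
    (hc : c = y • B 2 + (κ * Real.cos α) • B 0 + (κ * Real.sin α) • B 1)
    (hβ : 0 < β) (hκ : 0 < κ) (h0 : 0 < α) (h1 : α < π) :
    ENNReal.ofReal (2 * π) * volume (wedge3 a b c ∩ Metric.closedBall (0 : E3) 1) =
      ENNReal.ofReal α * volume (Metric.closedBall (0 : E3) 1) := by
  rw [← sector3 α h0 h1]
  have hsin := Real.sin_pos_of_pos_of_lt_pi h0 h1
  congr 1
  have hpre := B.measurePreserving_repr.measure_preimage_equiv (f := B.repr.toHomeomorph.toMeasurableEquiv)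
    {x : E3 | x ∈ Metric.closedBall (0 : E3) 1 ∧ 0 < x 1 ∧ 0 < x 0 * Real.sin α - x 1 * Real.cos α}
  rw [← hpre]
  congr 1
  ext x
  have hx : x = (B.repr x 0) • B 0 + (B.repr x 1) • B 1 + (B.repr x 2) • B 2 := by
    have := B.sum_repr x
    rw [Fin.sum_univ_three] at this
    exact this.symm
  have hbr : ∀ p q r : ℝ, (B.repr (p • B 0 + q • B 1 + r • B 2) 0 = p) ∧
      (B.repr (p • B 0 + q • B 1 + r • B 2) 1 = q) := by
    intro p q r
    simp 
  have hball : B.repr x ∈ Metric.closedBall (0 : E3) 1 ↔ x ∈ Metric.closedBall (0 : E3) 1 := by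
    simp
  constructor
  · rintro ⟨⟨l, m, n, hm, hn, hxe⟩, hxb⟩
    have hxe' : x = (m * β + n * (κ * Real.cos α)) • B 0 + (n * (κ * Real.sin α)) • B 1 + (l + m * z + n * y) • B 2 := by
      rw [hxe, ha, hb, hc]; module
    refine ⟨hball.mpr hxb, ?_, ?_⟩
    · change 0 < B.repr x 1
      rw [hxe', (hbr _ _ _).2]; positivity
    · change 0 < B.repr x 0 * Real.sin α - B.repr x 1 * Real.cos α
      rw [hxe', (hbr _ _ _).2, (hbr _ _ _).1]
      have : (m * β + n * (κ * Real.cos α)) * Real.sin α - n * (κ * Real.sin α) * Real.cos α = m * β * Real.sin α := by ring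
      rw [this]; positivity
  · rintro ⟨hxb, h1, h2⟩
    change 0 < B.repr x 1 at h1
    change 0 < B.repr x 0 * Real.sin α - B.repr x 1 * Real.cos α at h2
    refine ⟨?_, hball.mp hxb⟩
    obtain ⟨p, hp⟩ : ∃ p, p = B.repr x 0 := ⟨_, rfl⟩
    obtain ⟨q, hq⟩ : ∃ q, q = B.repr x 1 := ⟨_, rfl⟩
    obtain ⟨r, hr⟩ : ∃ r, r = B.repr x 2 := ⟨_, rfl⟩
    rw [← hp, ← hq, ← hr] at hx
    rw [← hp, ← hq] at h2
    rw [← hq] at h1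
    refine ⟨r - (p * Real.sin α - q * Real.cos α) / (β * Real.sin α) * z - q / (κ * Real.sin α) * y,
      (p * Real.sin α - q * Real.cos α) / (β * Real.sin α), q / (κ * Real.sin α), by positivity, by positivity, ?_⟩
    rw [hx, ha, hb, hc]
    match_scalars <;> field_simp <;> ring

lemma wedge_volume (a b c : E3) (ha : inner ℝ a a = (1:ℝ)) (hb : inner ℝ b b = (1:ℝ)) (hc : inner ℝ c c = (1:ℝ))
    (hd : 0 < |dt a b c|) :
    ENNReal.ofReal (2 * π) * volume (wedge3 a b c ∩ Metric.closedBall (0 : E3) 1) =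
      ENNReal.ofReal (Complex.arg ⟨inner ℝ b c - inner ℝ c a * inner ℝ a b, |dt a b c|⟩) *
        volume (Metric.closedBall (0 : E3) 1) := by
  have hG := gram3 a b c
  rw [ha, hb, hc] at hG
  obtain ⟨x, hx⟩ : ∃ x : ℝ, x = inner ℝ b c := ⟨_, rfl⟩
  obtain ⟨y, hy⟩ : ∃ y : ℝ, y = inner ℝ c a := ⟨_, rfl⟩
  obtain ⟨z, hz⟩ : ∃ z : ℝ, z = inner ℝ a b := ⟨_, rfl⟩
  rw [← hx, ← hy, ← hz] at hG
  rw [← hx, ← hy, ← hz]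
  obtain ⟨D, hD⟩ : ∃ D, D = |dt a b c| := ⟨_, rfl⟩
  rw [← sq_abs, ← hD] at hG
  rw [← hD] at hd
  rw [← hD]
  have hy' : inner ℝ a c = y := by rw [real_inner_comm, hy]
  have hz' : inner ℝ b a = z := by rw [real_inner_comm, hz]
  have hx' : inner ℝ c b = x := by rw [real_inner_comm, hx]
  have hG' : D ^ 2 = (1 - z ^ 2) * (1 - y ^ 2) - (x - y * z) ^ 2 := by rw [hG]; ring
  have hy1 : y ^ 2 ≤ 1 := by
    have := real_inner_mul_inner_self_le c a
    rw [ha, hc, ← hy] at this; nlinarith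
  have hz1 : z ^ 2 ≤ 1 := by
    have := real_inner_mul_inner_self_le a b
    rw [ha, hb, ← hz] at this; nlinarith
  have hz2 : 0 < 1 - z ^ 2 := by
    rcases eq_or_lt_of_le hz1 with h | h
    · rw [h] at hG'; nlinarith [pow_pos hd 2]
    · linarith
  obtain ⟨β, hβ⟩ : ∃ β, β = √(1 - z ^ 2) := ⟨_, rfl⟩
  have hβ0 : 0 < β := by rw [hβ]; exact Real.sqrt_pos.mpr hz2
  have hβ2 : β ^ 2 = 1 - z ^ 2 := by rw [hβ]; exact Real.sq_sqrt hz2.le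
  obtain ⟨e0, he0⟩ : ∃ e0, e0 = β⁻¹ • (b - z • a) := ⟨_, rfl⟩
  obtain ⟨c1, hc1⟩ : ∃ c1, c1 = (x - y * z) / β := ⟨_, rfl⟩
  obtain ⟨c2, hc2⟩ : ∃ c2, c2 = D / β := ⟨_, rfl⟩
  have hc20 : 0 < c2 := by rw [hc2]; positivity
  obtain ⟨e1, he1⟩ : ∃ e1, e1 = c2⁻¹ • (c - y • a - c1 • e0) := ⟨_, rfl⟩
  have i00 : inner ℝ e0 e0 = (1:ℝ) := by
    rw [he0]
    simp only [inner_smul_left, inner_smul_right, inner_sub_left, inner_sub_right, ha, hb, ← hz, hz']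
    simp
    field_simp
    rw [hβ2]
  have i0a : inner ℝ e0 a = (0:ℝ) := by
    rw [he0]
    simp only [inner_smul_left, inner_sub_left, ha, hz']
    simp
  have i0c : inner ℝ e0 c = c1 := by
    rw [he0, hc1]
    simp only [inner_smul_left, inner_sub_left, ← hx, hy']
    simp
    field_simp
  have ia0 : inner ℝ a e0 = (0:ℝ) := by rw [real_inner_comm, i0a]
  have ic0 : inner ℝ c e0 = c1 := by rw [real_inner_comm, i0c]
  have hcc : c2 ^ 2 = 1 - y ^ 2 - c1 ^ 2 := by
    rw [hc1, hc2]; field_simp; rw [hG', hβ2]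
  have i11 : inner ℝ e1 e1 = (1:ℝ) := by
    rw [he1]
    simp only [inner_smul_left, inner_smul_right, inner_sub_left, inner_sub_right, ha, hc, ← hy, hy', i00, i0a, i0c, ia0, ic0]
    simp
    field_simp
    rw [hcc]
  have i1a : inner ℝ e1 a = (0:ℝ) := by
    rw [he1]
    simp only [inner_smul_left, inner_sub_left, ha, ← hy, i0a]
    simp
  have i10 : inner ℝ e1 e0 = (0:ℝ) := by
    rw [he1]
    simp only [inner_smul_left, inner_sub_left, ia0, ic0, i00]
    simp
  have ia1 : inner ℝ a e1 = (0:ℝ) := by rw [real_inner_comm, i1a]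
  have i01 : inner ℝ e0 e1 = (0:ℝ) := by rw [real_inner_comm, i10]
  have hnorm : ∀ e : E3, inner ℝ e e = (1:ℝ) → ‖e‖ = 1 := by
    intro e he
    rw [real_inner_self_eq_norm_sq] at he
    exact (pow_eq_one_iff_of_nonneg (norm_nonneg e) two_ne_zero).mp he
  have n0 := hnorm _ i00
  have n1 := hnorm _ i11
  have n2 := hnorm _ ha
  have hon : Orthonormal ℝ ![e0, e1, a] := by
    rw [orthonormal_iff_ite]
    intro i j
    fin_cases i <;> fin_cases j <;> simp [n0, n1, n2, i01, i0a, i10, i1a, ia0, ia1]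
  have hcard : Fintype.card (Fin 3) = Module.finrank ℝ E3 := by simp
  have hbas := coe_basisOfOrthonormalOfCardEqFinrank hon hcard
  let B := (basisOfOrthonormalOfCardEqFinrank hon hcard).toOrthonormalBasis (by rw [hbas]; exact hon)
  have hB : ⇑B = ![e0, e1, a] := by
    simp [B]
  have B0 : B 0 = e0 := by rw [hB]; rfl
  have B1 : B 1 = e1 := by rw [hB]; rfl
  have B2 : B 2 = a := by rw [hB]; rfl
  have hne : (⟨c1, c2⟩ : ℂ) ≠ 0 := by
    intro h; have := congrArg Complex.im h; simp at this; linarith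
  obtain ⟨α, hα⟩ : ∃ α, α = Complex.arg ⟨c1, c2⟩ := ⟨_, rfl⟩
  have hα0 : 0 < α := by
    rw [hα]
    refine lt_of_le_of_ne (Complex.arg_nonneg_iff.mpr hc20.le) ?_
    intro h
    have := (Complex.arg_eq_zero_iff.mp h.symm).2
    simp at this; linarith
  have hα1 : α < π := by
    rw [hα]; exact Complex.arg_lt_pi_iff.mpr (Or.inr hc20.ne')
  have hκ : 0 < ‖(⟨c1, c2⟩ : ℂ)‖ := norm_pos_iff.mpr hne
  have k1 : c1 = ‖(⟨c1, c2⟩ : ℂ)‖ * Real.cos α := by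
    rw [hα, Complex.norm_mul_cos_arg]
  have k2 : c2 = ‖(⟨c1, c2⟩ : ℂ)‖ * Real.sin α := by
    rw [hα, Complex.norm_mul_sin_arg]
  have hαx : Complex.arg ⟨x - y * z, D⟩ = α := by
    have : (⟨x - y * z, D⟩ : ℂ) = (β : ℂ) * ⟨c1, c2⟩ := by
      apply Complex.ext
      · simp [hc1]; field_simp
      · simp [hc2]; field_simp
    rw [this, Complex.arg_real_mul _ hβ0, hα]
  rw [hαx]
  refine wedge_sector B a b c z y β ‖(⟨c1, c2⟩ : ℂ)‖ α B2.symm ?_ ?_ hβ0 hκ hα0 hα1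
  · rw [B2, B0, he0, smul_smul, mul_inv_cancel₀ hβ0.ne', one_smul]; abel
  · rw [← k1, ← k2, B2, B0, B1, he1, smul_smul, mul_inv_cancel₀ hc20.ne', one_smul]; abel


def dtL (b c : E3) : E3 →ₗ[ℝ] ℝ where
  toFun x := dt x b c
  map_add' x y := by simp [dt]; ring
  map_smul' r x := by simp [dt]; ring

lemma exists_coords (a b c : E3) (h : dt a b c ≠ 0) :
    ∃ f0 f1 f2 : E3 →ₗ[ℝ] ℝ, (∀ x, x = f0 x • a + f1 x • b + f2 x • c) ∧
      ∀ l m n : ℝ, f0 (l • a + m • b + n • c) = l ∧ f1 (l • a + m • b + n • c) = m ∧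
        f2 (l • a + m • b + n • c) = n := by
  refine ⟨(dt a b c)⁻¹ • dtL b c, (dt a b c)⁻¹ • dtL c a, (dt a b c)⁻¹ • dtL a b, ?_, ?_⟩
  · intro x
    have e : dt a b c • x = dt x b c • a + dt x c a • b + dt x a b • c := by
      ext i
      fin_cases i <;> simp [dt] <;> ring
    simp only [LinearMap.smul_apply, dtL, LinearMap.coe_mk, AddHom.coe_mk, smul_eq_mul]
    rw [mul_smul, mul_smul, mul_smul, ← smul_add, ← smul_add, ← e, smul_smul, inv_mul_cancel₀ h, one_smul]
  · intro l m n
    simp only [LinearMap.smul_apply, dtL, LinearMap.coe_mk, AddHom.coe_mk, smul_eq_mul]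
    refine ⟨?_, ?_, ?_⟩
    · have : dt (l • a + m • b + n • c) b c = l * dt a b c := by simp [dt]; ring
      rw [this]; field_simp
    · have : dt (l • a + m • b + n • c) c a = m * dt a b c := by simp [dt]; ring
      rw [this]; field_simp
    · have : dt (l • a + m • b + n • c) a b = n * dt a b c := by simp [dt]; ring
      rw [this]; field_simp

noncomputable def ballM : Measure E3 := volume.restrict (Metric.closedBall (0 : E3) 1)

instance : IsFiniteMeasure ballM :=
  ⟨by rw [ballM, Measure.restrict_apply_univ]; exact measure_closedBall_lt_top⟩

lemma ballM_ac : ballM ≪ volume := Measure.restrict_le_self.absolutelyContinuous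

lemma ballM_neg (S : Set E3) (hS : MeasurableSet S) : ballM.real (-S) = ballM.real S := by
  unfold Measure.real ballM
  rw [Measure.restrict_apply hS, Measure.restrict_apply hS.neg]
  have : -S ∩ Metric.closedBall (0 : E3) 1 = -(S ∩ Metric.closedBall (0 : E3) 1) := by
    ext x; simp
  rw [this, Measure.measure_neg]

lemma ker_null (f : E3 →ₗ[ℝ] ℝ) (hf : f ≠ 0) : volume {x | f x = 0} = 0 := by
  have : {x | f x = 0} = (LinearMap.ker f : Set E3) := by ext x; simp
  rw [this]
  apply Measure.addHaar_submodule
  intro h; exact hf (LinearMap.ker_eq_top.mp h)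

lemma ae_ne (f : E3 →ₗ[ℝ] ℝ) (hf : f ≠ 0) : ∀ᵐ x ∂ballM, f x ≠ 0 := by
  have : ∀ᵐ x ∂(volume : Measure E3), f x ≠ 0 := by
    rw [ae_iff]; simpa using ker_null f hf
  exact ballM_ac.ae_le this

lemma pos_meas (f : E3 →ₗ[ℝ] ℝ) : MeasurableSet {x | 0 < f x} := 
  measurableSet_lt measurable_const (LinearMap.continuous_of_finiteDimensional f).measurable

lemma half_ball (f : E3 →ₗ[ℝ] ℝ) (hf : f ≠ 0) : ballM.real {x | 0 < f x} = ballM.real Set.univ / 2 := by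
  have h1 := ballM_neg _ (pos_meas f)
  have h2 : (-{x | 0 < f x} : Set E3) =ᵐ[ballM] ({x | 0 < f x}ᶜ : Set E3) := by
    have : ∀ᵐ x ∂ballM, f x ≠ 0 := ae_ne f hf
    filter_upwards [this] with x hx
    apply propext
    change (-x ∈ {x | 0 < f x}) ↔ x ∈ ({x | 0 < f x}ᶜ : Set E3)
    simp
    exact ⟨fun h => h.le, fun h => lt_of_le_of_ne h hx⟩
  rw [measureReal_congr h2] at h1
  have h3 := measureReal_compl (μ := ballM) (pos_meas f)
  linarith

lemma girard_aux (f0 f1 f2 : E3 →ₗ[ℝ] ℝ) (h0 : f0 ≠ 0) (h1 : f1 ≠ 0) (h2 : f2 ≠ 0) :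
    ballM.real ({x | 0 < f1 x} ∩ {x | 0 < f2 x}) + ballM.real ({x | 0 < f2 x} ∩ {x | 0 < f0 x}) +
      ballM.real ({x | 0 < f0 x} ∩ {x | 0 < f1 x}) =
    2 * ballM.real ({x | 0 < f0 x} ∩ {x | 0 < f1 x} ∩ {x | 0 < f2 x}) + ballM.real Set.univ / 2 := by
  have a0 := half_ball f0 h0
  have a1 := half_ball f1 h1
  have a2 := half_ball f2 h2
  have m0 := pos_meas f0
  have m1 := pos_meas f1
  have m2 := pos_meas f2
  have n0 := ker_null f0 h0
  have n1 := ker_null f1 h1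
  have n2 := ker_null f2 h2
  set A := {x | 0 < f0 x} with hA
  set B := {x | 0 < f1 x} with hB
  set C := {x | 0 < f2 x} with hC
  have u1 := measureReal_union_add_inter (μ := ballM) (s := A) (t := B) m1
  have u2 := measureReal_union_add_inter (μ := ballM) (s := A ∪ B) (t := C) m2
  have u3 := measureReal_union_add_inter (μ := ballM) (s := A ∩ C) (t := B ∩ C) (m1.inter m2)
  rw [Set.union_inter_distrib_right] at u2
  have e3 : A ∩ C ∩ (B ∩ C) = A ∩ B ∩ C := by ext x; simp; tauto
  rw [e3] at u3
  have hc := measureReal_compl (μ := ballM) ((m0.union m1).union m2)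
  have hneg := ballM_neg _ ((m0.inter m1).inter m2)
  have heq : (-(A ∩ B ∩ C) : Set E3) =ᵐ[ballM] ((A ∪ B ∪ C)ᶜ : Set E3) := by
    have b0 : ∀ᵐ x ∂ballM, f0 x ≠ 0 := ae_ne f0 h0
    have b1 : ∀ᵐ x ∂ballM, f1 x ≠ 0 := ae_ne f1 h1
    have b2 : ∀ᵐ x ∂ballM, f2 x ≠ 0 := ae_ne f2 h2
    filter_upwards [b0, b1, b2] with x x0 x1 x2
    apply propext
    change (-x ∈ A ∩ B ∩ C) ↔ x ∈ ((A ∪ B ∪ C)ᶜ : Set E3)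
    simp [hA, hB, hC]
    constructor
    · rintro ⟨⟨p, q⟩, r⟩; exact ⟨⟨p.le, q.le⟩, r.le⟩
    · rintro ⟨⟨p, q⟩, r⟩; exact ⟨⟨lt_of_le_of_ne p x0, lt_of_le_of_ne q x1⟩, lt_of_le_of_ne r x2⟩
  rw [measureReal_congr heq] at hneg
  rw [Set.inter_comm C A]
  linarith

lemma cone3_isOpen (a b c : E3) (h : dt a b c ≠ 0) : IsOpen (cone3 a b c) := by
  obtain ⟨f0, f1, f2, hr, hl⟩ := exists_coords a b c h
  have : cone3 a b c = {x | 0 < f0 x} ∩ {x | 0 < f1 x} ∩ {x | 0 < f2 x} := by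
    ext x
    constructor
    · rintro ⟨l, m, n, p, q, r, rfl⟩
      obtain ⟨e0, e1, e2⟩ := hl l m n
      refine ⟨⟨?_, ?_⟩, ?_⟩
      · change 0 < f0 _; rw [e0]; exact p
      · change 0 < f1 _; rw [e1]; exact q
      · change 0 < f2 _; rw [e2]; exact r
    · rintro ⟨⟨p, q⟩, r⟩
      exact ⟨_, _, _, p, q, r, hr x⟩
  rw [this]
  have op : ∀ f : E3 →ₗ[ℝ] ℝ, IsOpen {x | 0 < f x} := fun f =>
    isOpen_lt continuous_const (LinearMap.continuous_of_finiteDimensional f)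
  exact ((op f0).inter (op f1)).inter (op f2)

lemma cone3_pos (a b c : E3) (h : dt a b c ≠ 0) : 0 < ballM.real (cone3 a b c) := by
  have ho := cone3_isOpen a b c h
  unfold Measure.real
  apply ENNReal.toReal_pos _ (measure_ne_top _ _)
  unfold ballM
  rw [Measure.restrict_apply ho.measurableSet]
  have hsub : cone3 a b c ∩ Metric.ball (0 : E3) 1 ⊆ cone3 a b c ∩ Metric.closedBall (0 : E3) 1 :=
    Set.inter_subset_inter_right _ Metric.ball_subset_closedBall
  have hpos : 0 < volume (cone3 a b c ∩ Metric.ball (0 : E3) 1) := by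
    apply IsOpen.measure_pos volume (ho.inter Metric.isOpen_ball)
    set u := a + b + c
    have hn : 0 < 1 + ‖u‖ := by positivity
    refine ⟨(1 + ‖u‖)⁻¹ • u, ⟨(1 + ‖u‖)⁻¹, (1 + ‖u‖)⁻¹, (1 + ‖u‖)⁻¹, by positivity, by positivity, by positivity, ?_⟩, ?_⟩
    · simp only [u, smul_add]
    · rw [mem_ball_zero_iff, norm_smul, norm_inv, Real.norm_of_nonneg hn.le, inv_mul_lt_iff₀ hn]
      linarith
  exact (lt_of_lt_of_le hpos (measure_mono hsub)).ne'

lemma girard (a b c : E3) (h : dt a b c ≠ 0) :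
    ballM.real (wedge3 a b c) + ballM.real (wedge3 b c a) + ballM.real (wedge3 c a b) =
      2 * ballM.real (cone3 a b c) + ballM.real Set.univ / 2 ∧
    ballM.real (cone3 a b c) < ballM.real Set.univ / 2 := by
  have hpos := cone3_pos a (-b) c (by
    have : dt a (-b) c = - dt a b c := by simp [dt]; ring
    rw [this]; simpa using h)
  have hop := cone3_isOpen a (-b) c (by
    have : dt a (-b) c = - dt a b c := by simp [dt]; ring
    rw [this]; simpa using h)
  obtain ⟨f0, f1, f2, hr, hl⟩ := exists_coords a b c h
  have w1 : wedge3 a b c = {x | 0 < f1 x} ∩ {x | 0 < f2 x} := by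
    ext x
    constructor
    · rintro ⟨l, m, n, q, r, rfl⟩
      obtain ⟨e0, e1, e2⟩ := hl l m n
      refine ⟨?_, ?_⟩
      · change 0 < f1 _; rw [e1]; exact q
      · change 0 < f2 _; rw [e2]; exact r
    · rintro ⟨q, r⟩
      exact ⟨_, _, _, q, r, hr x⟩
  have w2 : wedge3 b c a = {x | 0 < f2 x} ∩ {x | 0 < f0 x} := by
    ext x
    constructor
    · rintro ⟨m, n, l, q, r, rfl⟩
      obtain ⟨e0, e1, e2⟩ := hl l m n
      rw [show m • b + n • c + l • a = l • a + m • b + n • c by abel]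
      refine ⟨?_, ?_⟩
      · change 0 < f2 _; rw [e2]; exact q
      · change 0 < f0 _; rw [e0]; exact r
    · rintro ⟨q, r⟩
      exact ⟨f1 x, f2 x, f0 x, q, r, (hr x).trans (by abel)⟩
  have w3 : wedge3 c a b = {x | 0 < f0 x} ∩ {x | 0 < f1 x} := by
    ext x
    constructor
    · rintro ⟨n, l, m, q, r, rfl⟩
      obtain ⟨e0, e1, e2⟩ := hl l m n
      rw [show n • c + l • a + m • b = l • a + m • b + n • c by abel]
      refine ⟨?_, ?_⟩
      · change 0 < f0 _; rw [e0]; exact q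
      · change 0 < f1 _; rw [e1]; exact r
    · rintro ⟨q, r⟩
      exact ⟨f2 x, f0 x, f1 x, q, r, (hr x).trans (by abel)⟩
  have hc : cone3 a b c = {x | 0 < f0 x} ∩ {x | 0 < f1 x} ∩ {x | 0 < f2 x} := by
    ext x
    constructor
    · rintro ⟨l, m, n, p, q, r, rfl⟩
      obtain ⟨e0, e1, e2⟩ := hl l m n
      refine ⟨⟨?_, ?_⟩, ?_⟩
      · change 0 < f0 _; rw [e0]; exact p
      · change 0 < f1 _; rw [e1]; exact q
      · change 0 < f2 _; rw [e2]; exact r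
    · rintro ⟨⟨p, q⟩, r⟩
      exact ⟨_, _, _, p, q, r, hr x⟩
  have z0 : f0 ≠ 0 := by
    intro hz; have := (hl 1 0 0).1; rw [hz] at this; simp at this
  have z1 : f1 ≠ 0 := by
    intro hz; have := (hl 0 1 0).2.1; rw [hz] at this; simp at this
  have z2 : f2 ≠ 0 := by
    intro hz; have := (hl 0 0 1).2.2; rw [hz] at this; simp at this
  refine ⟨?_, ?_⟩
  · rw [w1, w2, w3, hc]
    exact girard_aux f0 f1 f2 z0 z1 z2
  · rw [← half_ball f0 z0]
    have hdis : Disjoint (cone3 a b c) (cone3 a (-b) c) := by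
      rw [Set.disjoint_left]
      rintro x ⟨l, m, n, p, q, r, hx⟩ ⟨l', m', n', p', q', r', hx'⟩
      have e1 := (hl l m n).2.1
      rw [← hx] at e1
      have e2 := (hl l' (-m') n').2.1
      rw [show l' • a + (-m') • b + n' • c = l' • a + m' • (-b) + n' • c by simp, ← hx'] at e2
      linarith
    have hU := measureReal_union (μ := ballM) hdis hop.measurableSet
    have hmono : ballM.real (cone3 a b c ∪ cone3 a (-b) c) ≤ ballM.real {x | 0 < f0 x} := by
      refine measureReal_mono ?_ (measure_ne_top _ _)
      rintro x (hx | ⟨l', m', n', p', q', r', hx'⟩)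
      · rw [hc] at hx; exact hx.1.1
      · have e2 := (hl l' (-m') n').1
        rw [show l' • a + (-m') • b + n' • c = l' • a + m' • (-b) + n' • c by simp, ← hx'] at e2
        change 0 < f0 x
        rw [e2]; exact p'
    linarith

lemma wedge_real (a b c : E3) (ha : inner ℝ a a = (1:ℝ)) (hb : inner ℝ b b = (1:ℝ)) (hc : inner ℝ c c = (1:ℝ))
    (hd : 0 < |dt a b c|) :
    2 * π * ballM.real (wedge3 a b c) =
      Complex.arg ⟨inner ℝ b c - inner ℝ c a * inner ℝ a b, |dt a b c|⟩ * ballM.real Set.univ := by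
  have h := congrArg ENNReal.toReal (wedge_volume a b c ha hb hc hd)
  rw [ENNReal.toReal_mul, ENNReal.toReal_mul, ENNReal.toReal_ofReal (by positivity),
    ENNReal.toReal_ofReal (Complex.arg_nonneg_iff.mpr hd.le)] at h
  unfold Measure.real ballM
  rw [Measure.restrict_apply_univ, Measure.restrict_apply' measurableSet_closedBall]
  exact h

lemma triangle_unit (a b c : E3) (ha : inner ℝ a a = (1:ℝ)) (hb : inner ℝ b b = (1:ℝ)) (hc : inner ℝ c c = (1:ℝ))
    (h : dt a b c ≠ 0) :
    |dt a b c| / 6 ≤ gF (π / 6 + (2 * π / 3) * (ballM.real (cone3 a b c) / ballM.real Set.univ)) := by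
  obtain ⟨g1, g2⟩ := girard a b c h
  have hv := cone3_pos a b c h
  have hpi := Real.pi_pos
  have hd : 0 < |dt a b c| := abs_pos.mpr h
  have c1 : dt b c a = dt a b c := by simp [dt]; ring
  have c2 : dt c a b = dt a b c := by simp [dt]; ring
  have w1 := wedge_real a b c ha hb hc hd
  have w2 := wedge_real b c a hb hc ha (by rw [c1]; exact hd)
  have w3 := wedge_real c a b hc ha hb (by rw [c2]; exact hd)
  rw [c1] at w2
  rw [c2] at w3
  have hG := gram3 a b c
  rw [ha, hb, hc, ← sq_abs] at hG
  have hx1 : inner ℝ b c ^ 2 ≤ (1:ℝ) := by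
    have := real_inner_mul_inner_self_le b c
    rw [hb, hc] at this; nlinarith
  have hy1 : inner ℝ c a ^ 2 ≤ (1:ℝ) := by
    have := real_inner_mul_inner_self_le c a
    rw [ha, hc] at this; nlinarith
  have hz1 : inner ℝ a b ^ 2 ≤ (1:ℝ) := by
    have := real_inner_mul_inner_self_le a b
    rw [ha, hb] at this; nlinarith
  have hs : 0 ≤ 3 + 2 * (inner ℝ b c + inner ℝ c a + inner ℝ a b : ℝ) := by
    have := real_inner_self_nonneg (x := a + b + c)
    simp only [inner_add_left, inner_add_right, ha, hb, hc] at this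
    rw [real_inner_comm c b, real_inner_comm b a, real_inner_comm a c] at this
    rw [real_inner_comm c b, real_inner_comm b a, real_inner_comm a c]
    linarith
  obtain ⟨x, hx⟩ : ∃ x : ℝ, x = inner ℝ b c := ⟨_, rfl⟩
  obtain ⟨y, hy⟩ : ∃ y : ℝ, y = inner ℝ c a := ⟨_, rfl⟩
  obtain ⟨z, hz⟩ : ∃ z : ℝ, z = inner ℝ a b := ⟨_, rfl⟩
  obtain ⟨D, hD⟩ : ∃ D, D = |dt a b c| := ⟨_, rfl⟩
  obtain ⟨V, hV⟩ : ∃ V, V = ballM.real (cone3 a b c) := ⟨_, rfl⟩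
  obtain ⟨M, hM⟩ : ∃ M, M = ballM.real Set.univ := ⟨_, rfl⟩
  rw [← hx, ← hy, ← hz] at w1 w2 w3 hG hs
  rw [← hx] at hx1
  rw [← hy] at hy1
  rw [← hz] at hz1
  rw [← hD] at w1 w2 w3 hG hd ⊢
  rw [← hM] at w1 w2 w3 g1 g2 ⊢
  rw [← hV] at g1 g2 hv ⊢
  have hM0 : 0 < M := by linarith
  have hsq : ∀ p q r : ℝ, p ^ 2 ≤ 1 → q ^ 2 ≤ 1 → D ^ 2 = (1 - p ^ 2) * (1 - q ^ 2) - r ^ 2 → p ^ 2 < 1 := by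
    intro p q r hp hq he
    rcases eq_or_lt_of_le hp with h' | h'
    · rw [h'] at he; nlinarith [pow_pos hd 2]
    · exact h'
  have hx2 := hsq x y (z - x * y) hx1 hy1 (by rw [hG]; ring)
  have hy2 := hsq y x (z - x * y) hy1 hx1 (by rw [hG]; ring)
  have hz2 := hsq z x (y - z * x) hz1 hx1 (by rw [hG]; ring)
  have hsum : (Complex.arg ⟨x - y * z, D⟩ + Complex.arg ⟨y - z * x, D⟩ + Complex.arg ⟨z - x * y, D⟩ - π) * M = 4 * π * V := by
    linear_combination - w1 - w2 - w3 + 2 * π * g1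
  have hsum' : Complex.arg ⟨x - y * z, D⟩ + Complex.arg ⟨y - z * x, D⟩ + Complex.arg ⟨z - x * y, D⟩ - π = 4 * π * (V / M) := by
    rw [← mul_div_assoc, eq_div_iff hM0.ne']; exact hsum
  have hVM0 : 0 < V / M := by positivity
  have hVM1 : V / M < 1 / 2 := by rw [div_lt_iff₀ hM0]; linarith
  have hid := angle_identity hd hx2 hy2 hz2 (by rw [hG]; ring)
    (by rw [hsum']; positivity) (by rw [hsum']; nlinarith)
  rw [hsum'] at hid
  have hth : Complex.arg ⟨1 + (x + y + z), D⟩ = 2 * π * (V / M) := by linarith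
  have hne : (⟨1 + (x + y + z), D⟩ : ℂ) ≠ 0 := by
    intro h; have := congrArg Complex.im h; simp at this; linarith
  have hle : ∀ p : ℝ, p ^ 2 < 1 → p ≤ 1 := fun p hp => by
    have := (sq_lt_one_iff_abs_lt_one p).mp hp
    exact (le_abs_self p).trans this.le
  have hxl := hle x hx2
  have hyl := hle y hy2
  have hzl := hle z hz2
  have hthp : 2 * π * (V / M) < π := by
    have := mul_lt_mul_of_pos_left hVM1 (by positivity : 0 < 2 * π)
    linarith
  have hgr := gram_le hxl hyl hzl hs
  have hfin := trig_bound (s := x + y + z) (D := D) (th := 2 * π * (V / M)) (r := ‖(⟨1 + (x + y + z), D⟩ : ℂ)‖)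
    (by positivity) hthp (norm_pos_iff.mpr hne)
    (by rw [← hth, Complex.norm_mul_cos_arg]) (by rw [← hth, Complex.norm_mul_sin_arg])
    (by linarith) (by rw [hG]; linarith)
  rw [show π / 6 + 2 * π / 3 * (V / M) = π / 6 + 2 * π * (V / M) / 3 by ring]
  exact hfin

lemma triangle_bound (a b c : E3) (ha : ‖a‖ ≤ 1) (hb : ‖b‖ ≤ 1) (hc : ‖c‖ ≤ 1)
    (h : dt a b c ≠ 0) :
    |dt a b c| / 6 ≤ gF (π / 6 + (2 * π / 3) * (ballM.real (cone3 a b c) / ballM.real Set.univ)) := by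
  have ha0 : 0 < ‖a‖ := norm_pos_iff.mpr (by rintro rfl; simp [dt] at h)
  have hb0 : 0 < ‖b‖ := norm_pos_iff.mpr (by rintro rfl; simp [dt] at h)
  have hc0 : 0 < ‖c‖ := norm_pos_iff.mpr (by rintro rfl; simp [dt] at h)
  have hdt : dt a b c = ‖a‖ * ‖b‖ * ‖c‖ * dt (‖a‖⁻¹ • a) (‖b‖⁻¹ • b) (‖c‖⁻¹ • c) := by
    simp [dt]; field_simp
  have hun : ∀ u : E3, 0 < ‖u‖ → inner ℝ (‖u‖⁻¹ • u) (‖u‖⁻¹ • u) = (1:ℝ) := by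
    intro u hu
    rw [real_inner_self_eq_norm_sq, norm_smul, norm_inv, norm_norm, inv_mul_cancel₀ hu.ne', one_pow]
  have hcone : cone3 (‖a‖⁻¹ • a) (‖b‖⁻¹ • b) (‖c‖⁻¹ • c) = cone3 a b c := by
    ext x
    constructor
    · rintro ⟨l, m, n, hl, hm, hn, rfl⟩
      exact ⟨l * ‖a‖⁻¹, m * ‖b‖⁻¹, n * ‖c‖⁻¹, by positivity, by positivity, by positivity, by simp only [smul_smul]⟩
    · rintro ⟨l, m, n, hl, hm, hn, rfl⟩
      refine ⟨l * ‖a‖, m * ‖b‖, n * ‖c‖, by positivity, by positivity, by positivity, ?_⟩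
      simp only [smul_smul]
      rw [mul_assoc, mul_inv_cancel₀ ha0.ne', mul_assoc, mul_inv_cancel₀ hb0.ne', mul_assoc, mul_inv_cancel₀ hc0.ne', mul_one, mul_one, mul_one]
  have hne : dt (‖a‖⁻¹ • a) (‖b‖⁻¹ • b) (‖c‖⁻¹ • c) ≠ 0 := by
    intro h0; rw [h0, mul_zero] at hdt; exact h hdt
  have key := triangle_unit _ _ _ (hun a ha0) (hun b hb0) (hun c hc0) hne
  rw [hcone] at key
  refine le_trans ?_ key
  have h1 : ‖a‖ * ‖b‖ * ‖c‖ ≤ 1 := by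
    have := mul_le_one₀ ha hb0.le hb
    exact mul_le_one₀ this hc0.le hc
  rw [hdt, abs_mul, abs_of_pos (by positivity : 0 < ‖a‖ * ‖b‖ * ‖c‖)]
  have := abs_nonneg (dt (‖a‖⁻¹ • a) (‖b‖⁻¹ • b) (‖c‖⁻¹ • c))
  gcongr
  nlinarith


lemma tri_vol (s : ℝ) : volume {q : ℝ × ℝ | 0 ≤ q.1 ∧ 0 ≤ q.2 ∧ q.1 + q.2 ≤ s} = ENNReal.ofReal (if 0 ≤ s then s ^ 2 / 2 else 0) := by
  have hm : MeasurableSet {q : ℝ × ℝ | 0 ≤ q.1 ∧ 0 ≤ q.2 ∧ q.1 + q.2 ≤ s} := by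
    apply MeasurableSet.inter
    · exact measurableSet_le measurable_const measurable_fst
    apply MeasurableSet.inter
    · exact measurableSet_le measurable_const measurable_snd
    · exact measurableSet_le (measurable_fst.add measurable_snd) measurable_const
  rw [Measure.volume_eq_prod, Measure.prod_apply hm]
  have h1 : ∀ x : ℝ, volume (Prod.mk x ⁻¹' {q : ℝ × ℝ | 0 ≤ q.1 ∧ 0 ≤ q.2 ∧ q.1 + q.2 ≤ s}) =
      (Set.Icc 0 s).indicator (fun x => ENNReal.ofReal (s - x)) x := by
    intro x
    by_cases hx : x ∈ Set.Icc 0 s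
    · rw [Set.indicator_of_mem hx]
      have : Prod.mk x ⁻¹' {q : ℝ × ℝ | 0 ≤ q.1 ∧ 0 ≤ q.2 ∧ q.1 + q.2 ≤ s} = Set.Icc 0 (s - x) := by
        ext y
        simp only [Set.mem_preimage, Set.mem_ofPred_eq, Set.mem_Icc]
        constructor
        · rintro ⟨_, h, h'⟩; exact ⟨h, by linarith⟩
        · rintro ⟨h, h'⟩; exact ⟨hx.1, h, by linarith⟩
      rw [this, Real.volume_Icc, sub_zero]
    · rw [Set.indicator_of_notMem hx]
      have : Prod.mk x ⁻¹' {q : ℝ × ℝ | 0 ≤ q.1 ∧ 0 ≤ q.2 ∧ q.1 + q.2 ≤ s} = ∅ := by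
        ext y
        simp only [Set.mem_preimage, Set.mem_ofPred_eq, Set.mem_empty_iff_false, iff_false]
        rintro ⟨h0, h, h'⟩
        exact hx ⟨h0, by linarith⟩
      rw [this, measure_empty]
  rw [lintegral_congr h1, lintegral_indicator measurableSet_Icc]
  split_ifs with hs
  · rw [← ofReal_integral_eq_lintegral_ofReal]
    · congr 1
      rw [integral_Icc_eq_integral_Ioc, ← intervalIntegral.integral_of_le hs]
      rw [intervalIntegral.integral_sub (by simp) (by simp)]
      simp
      ring
    · exact (Continuous.continuousOn (by fun_prop)).integrableOn_compact isCompact_Icc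
    · filter_upwards [ae_restrict_mem measurableSet_Icc] with x hx
      simpa using hx.2
  · rw [Set.Icc_eq_empty hs]; simp

lemma simplex_vol (K : ℝ) (hK : 0 ≤ K) : volume {x : E3 | 0 ≤ x 0 ∧ 0 ≤ x 1 ∧ 0 ≤ x 2 ∧ x 0 + x 1 + x 2 ≤ K} = ENNReal.ofReal (K ^ 3 / 6) := by
  have hm : MeasurableSet {q : ℝ × ℝ × ℝ | 0 ≤ q.2.1 ∧ 0 ≤ q.2.2 ∧ 0 ≤ q.1 ∧ q.2.1 + q.2.2 + q.1 ≤ K} := by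
    apply MeasurableSet.inter
    · exact measurableSet_le measurable_const measurable_snd.fst
    apply MeasurableSet.inter
    · exact measurableSet_le measurable_const measurable_snd.snd
    apply MeasurableSet.inter
    · exact measurableSet_le measurable_const measurable_fst
    · exact measurableSet_le ((measurable_snd.fst.add measurable_snd.snd).add measurable_fst) measurable_const
  have h0 := coordMap_mp.measure_preimage hm.nullMeasurableSet
  have e : coordMap ⁻¹' {q : ℝ × ℝ × ℝ | 0 ≤ q.2.1 ∧ 0 ≤ q.2.2 ∧ 0 ≤ q.1 ∧ q.2.1 + q.2.2 + q.1 ≤ K} =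
    {x : E3 | 0 ≤ x 0 ∧ 0 ≤ x 1 ∧ 0 ≤ x 2 ∧ x 0 + x 1 + x 2 ≤ K} := by
    ext x; rfl
  rw [e] at h0
  rw [h0, Measure.volume_eq_prod, Measure.prod_apply hm]
  have h1 : ∀ z : ℝ, volume (Prod.mk z ⁻¹' {q : ℝ × ℝ × ℝ | 0 ≤ q.2.1 ∧ 0 ≤ q.2.2 ∧ 0 ≤ q.1 ∧ q.2.1 + q.2.2 + q.1 ≤ K}) =
      (Set.Icc 0 K).indicator (fun x => ENNReal.ofReal ((K - x) ^ 2 / 2)) z := by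
    intro z
    by_cases hz : z ∈ Set.Icc 0 K
    · rw [Set.indicator_of_mem hz]
      have : Prod.mk z ⁻¹' {q : ℝ × ℝ × ℝ | 0 ≤ q.2.1 ∧ 0 ≤ q.2.2 ∧ 0 ≤ q.1 ∧ q.2.1 + q.2.2 + q.1 ≤ K} =
          {q : ℝ × ℝ | 0 ≤ q.1 ∧ 0 ≤ q.2 ∧ q.1 + q.2 ≤ K - z} := by
        ext y
        simp only [Set.mem_preimage, Set.mem_ofPred_eq]
        constructor
        · rintro ⟨_, h, h', h''⟩; exact ⟨by assumption, h, by linarith⟩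
        · rintro ⟨h, h', h''⟩; exact ⟨h, h', hz.1, by linarith⟩
      rw [this, tri_vol, if_pos (by linarith [hz.2])]
    · rw [Set.indicator_of_notMem hz]
      have : Prod.mk z ⁻¹' {q : ℝ × ℝ × ℝ | 0 ≤ q.2.1 ∧ 0 ≤ q.2.2 ∧ 0 ≤ q.1 ∧ q.2.1 + q.2.2 + q.1 ≤ K} = ∅ := by
        ext y
        simp only [Set.mem_preimage, Set.mem_ofPred_eq, Set.mem_empty_iff_false, iff_false]
        rintro ⟨h0, h, h', h''⟩
        exact hz ⟨h', by linarith⟩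
      rw [this, measure_empty]
  rw [lintegral_congr h1, lintegral_indicator measurableSet_Icc]
  rw [← ofReal_integral_eq_lintegral_ofReal]
  · congr 1
    rw [integral_Icc_eq_integral_Ioc, ← intervalIntegral.integral_of_le hK]
    rw [intervalIntegral.integral_comp_sub_left (fun x => x ^ 2 / 2) K]
    simp
    ring
  · exact (Continuous.continuousOn (by fun_prop)).integrableOn_compact isCompact_Icc
  · filter_upwards with x
    simp; positivity

def tetra (K : ℝ) (a b c : E3) : Set E3 :=
  {x | ∃ l m n : ℝ, 0 ≤ l ∧ 0 ≤ m ∧ 0 ≤ n ∧ l + m + n ≤ K ∧ x = l • a + m • b + n • c}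

def linT (a b c : E3) : E3 →ₗ[ℝ] E3 where
  toFun x := x 0 • a + x 1 • b + x 2 • c
  map_add' x y := by simp [add_smul]; abel
  map_smul' r x := by simp [mul_smul]

lemma linT_det (a b c : E3) : LinearMap.det (linT a b c) = dt a b c := by
  rw [← LinearMap.det_toMatrix (EuclideanSpace.basisFun (Fin 3) ℝ).toBasis, Matrix.det_fin_three]
  simp [LinearMap.toMatrix_apply, linT, dt]
  ring

lemma tetra_vol (K : ℝ) (hK : 0 ≤ K) (a b c : E3) :
    volume (tetra K a b c) = ENNReal.ofReal (K ^ 3 * (|dt a b c| / 6)) := by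
  have : tetra K a b c = linT a b c '' {x : E3 | 0 ≤ x 0 ∧ 0 ≤ x 1 ∧ 0 ≤ x 2 ∧ x 0 + x 1 + x 2 ≤ K} := by
    ext x
    constructor
    · rintro ⟨l, m, n, hl, hm, hn, hs, rfl⟩
      exact ⟨!₂[l, m, n], ⟨by simpa using hl, by simpa using hm, by simpa using hn, by simpa using hs⟩, by simp [linT]⟩
    · rintro ⟨y, ⟨hl, hm, hn, hs⟩, rfl⟩
      exact ⟨_, _, _, hl, hm, hn, hs, rfl⟩
  rw [this, Measure.addHaar_image_linearMap, simplex_vol K hK, linT_det, ← ENNReal.ofReal_mul (abs_nonneg _)]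
  congr 1; ring


lemma hull_range {n : ℕ} (q : Fin n → E3) (x : E3) (hx : x ∈ convexHull ℝ (Set.range q)) :
    ∃ w : Fin n → ℝ, (∀ i, 0 ≤ w i) ∧ ∑ i, w i = 1 ∧ ∑ i, w i • q i = x := by
  have : convexHull ℝ (Set.range q) ⊆ {x | ∃ w : Fin n → ℝ, (∀ i, 0 ≤ w i) ∧ ∑ i, w i = 1 ∧ ∑ i, w i • q i = x} := by
    apply convexHull_min
    · rintro _ ⟨i, rfl⟩
      refine ⟨Pi.single i 1, ?_, by simp, ?_⟩
      · intro j
        by_cases h : j = i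
        · subst h; simp
        · simp [h]
      · simp [Pi.single_apply]
    · rintro x ⟨w, h0, h1, rfl⟩ y ⟨w', h0', h1', rfl⟩ a b ha hb hab
      refine ⟨fun i => a * w i + b * w' i, ?_, ?_, ?_⟩
      · intro i; have := h0 i; have := h0' i; positivity
      · rw [Finset.sum_add_distrib, ← Finset.mul_sum, ← Finset.mul_sum, h1, h1']; linarith
      · simp only [add_smul, mul_smul, Finset.sum_add_distrib, Finset.smul_sum]
  exact this hx

def Gen {n : ℕ} (p : Fin n → E3) (c : Fin n → ℝ) : Prop :=
  ∀ F : Finset (Fin n), (∃ f : E3 →ₗ[ℝ] ℝ, ∀ i ∈ F, f (p i) = c i) → LinearIndepOn ℝ p (F : Set (Fin n))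

def IsFacet {n : ℕ} (p : Fin n → E3) (c : Fin n → ℝ) (S : Finset (Fin n)) : Prop :=
  S.card = 3 ∧ ∃ f : E3 →ₗ[ℝ] ℝ, (∀ i ∈ S, f (p i) = c i) ∧ ∀ i, i ∉ S → f (p i) < c i

def coneS {n : ℕ} (p : Fin n → E3) (S : Finset (Fin n)) : Set E3 :=
  {x | ∃ l : Fin n → ℝ, (∀ i ∈ S, 0 < l i) ∧ x = ∑ i ∈ S, l i • p i}

def wedgeS {n : ℕ} (p : Fin n → E3) (S : Finset (Fin n)) (i : Fin n) : Set E3 :=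
  {x | ∃ l : Fin n → ℝ, (∀ j ∈ S, j ≠ i → 0 < l j) ∧ x = ∑ j ∈ S, l j • p j}

def tetraS {n : ℕ} (K : ℝ) (p : Fin n → E3) (S : Finset (Fin n)) : Set E3 :=
  {x | ∃ l : Fin n → ℝ, (∀ i ∈ S, 0 ≤ l i) ∧ ∑ i ∈ S, l i ≤ K ∧ x = ∑ i ∈ S, l i • p i}

lemma cone_disj {n : ℕ} (p : Fin n → E3) (c : Fin n → ℝ) {S T : Finset (Fin n)}
    (hS : IsFacet p c S) (hT : IsFacet p c T) (hne : S ≠ T) {x : E3} (hxS : x ∈ coneS p S) (hxT : x ∈ coneS p T) : False := by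
  have key : ∀ {S T : Finset (Fin n)}, IsFacet p c S → IsFacet p c T → S ≠ T → ∀ l m : Fin n → ℝ,
      (∀ i ∈ T, 0 < m i) → ∑ i ∈ S, l i • p i = ∑ i ∈ T, m i • p i →
      ∑ i ∈ S, l i * c i < ∑ i ∈ T, m i * c i := by
    intro S T hS hT hne l m hm he
    obtain ⟨hc, f, hf, hf'⟩ := hS
    have h1 := congrArg f he
    simp only [map_sum, map_smul, smul_eq_mul] at h1
    have h2 : ∑ i ∈ S, l i * f (p i) = ∑ i ∈ S, l i * c i :=
      Finset.sum_congr rfl (fun i hi => by rw [hf i hi])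
    rw [← h2, h1]
    have hnot : ¬ T ⊆ S := by
      intro hsub
      exact hne (Finset.eq_of_subset_of_card_le hsub (by rw [hc, hT.1])).symm
    obtain ⟨j, hjT, hjS⟩ := Finset.not_subset.mp hnot
    apply Finset.sum_lt_sum
    · intro i hi
      apply mul_le_mul_of_nonneg_left _ (hm i hi).le
      by_cases h : i ∈ S
      · exact (hf i h).le
      · exact (hf' i h).le
    · exact ⟨j, hjT, mul_lt_mul_of_pos_left (hf' j hjS) (hm j hjT)⟩
  obtain ⟨l, hl, rfl⟩ := hxS
  obtain ⟨m, hm, he⟩ := hxT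
  have a := key hS hT hne l m hm he
  have b := key hT hS hne.symm m l hl he.symm
  linarith

lemma wedge_to_cone {n : ℕ} (p : Fin n → E3) (S : Finset (Fin n)) (i : Fin n) (hi : i ∈ S) {x : E3}
    (hx : x ∈ wedgeS p S i) : ∃ M0 : ℝ, ∀ M, M0 < M → x + M • p i ∈ coneS p S := by
  obtain ⟨l, hl, rfl⟩ := hx
  refine ⟨- l i, fun M hM => ⟨fun j => l j + if j = i then M else 0, ?_, ?_⟩⟩
  · intro j hj
    by_cases h : j = i
    · subst h; simp; linarith
    · simpa [h] using hl j hj h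
  · simp [add_smul, Finset.sum_add_distrib, ite_smul, hi]

lemma wedge_disj {n : ℕ} (p : Fin n → E3) (c : Fin n → ℝ) {S T : Finset (Fin n)}
    (hS : IsFacet p c S) (hT : IsFacet p c T) (hne : S ≠ T) (i : Fin n) (hiS : i ∈ S) (hiT : i ∈ T)
    {x : E3} (hxS : x ∈ wedgeS p S i) (hxT : x ∈ wedgeS p T i) : False := by
  obtain ⟨M0, h0⟩ := wedge_to_cone p S i hiS hxS
  obtain ⟨M1, h1⟩ := wedge_to_cone p T i hiT hxT
  exact cone_disj p c hS hT hne (h0 (max M0 M1 + 1) (by have := le_max_left M0 M1; linarith))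
    (h1 (max M0 M1 + 1) (by have := le_max_right M0 M1; linarith))

lemma wedge3_isOpen (a b c : E3) (h : dt a b c ≠ 0) : IsOpen (wedge3 a b c) := by
  obtain ⟨f0, f1, f2, hr, hl⟩ := exists_coords a b c h
  have : wedge3 a b c = {x | 0 < f1 x} ∩ {x | 0 < f2 x} := by
    ext x
    constructor
    · rintro ⟨l, m, n, q, r, rfl⟩
      obtain ⟨e0, e1, e2⟩ := hl l m n
      refine ⟨?_, ?_⟩
      · change 0 < f1 _; rw [e1]; exact q
      · change 0 < f2 _; rw [e2]; exact r
    · rintro ⟨q, r⟩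
      exact ⟨_, _, _, q, r, hr x⟩
  rw [this]
  have op : ∀ f : E3 →ₗ[ℝ] ℝ, IsOpen {x | 0 < f x} := fun f =>
    isOpen_lt continuous_const (LinearMap.continuous_of_finiteDimensional f)
  exact (op f1).inter (op f2)

section
variable {n : ℕ} (p : Fin n → E3) {i j k : Fin n} (hij : i ≠ j) (hik : i ≠ k) (hjk : j ≠ k)

lemma sum3 (hij : i ≠ j) (hik : i ≠ k) (hjk : j ≠ k) (l : Fin n → ℝ) :
    ∑ a ∈ ({i, j, k} : Finset (Fin n)), l a • p a = l i • p i + l j • p j + l k • p k := by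
  rw [Finset.sum_insert (by simp [hij, hik]), Finset.sum_insert (by simp [hjk]), Finset.sum_singleton, add_assoc]

lemma exists_fun3 (hij : i ≠ j) (hik : i ≠ k) (hjk : j ≠ k) (a b c : ℝ) :
    ∃ l : Fin n → ℝ, l i = a ∧ l j = b ∧ l k = c :=
  ⟨fun t => if t = i then a else if t = j then b else c, by simp, by simp [hij.symm], by simp [hik.symm, hjk.symm]⟩

lemma coneS_eq (hij : i ≠ j) (hik : i ≠ k) (hjk : j ≠ k) : coneS p {i, j, k} = cone3 (p i) (p j) (p k) := by
  ext x
  constructor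
  · rintro ⟨l, hl, rfl⟩
    exact ⟨l i, l j, l k, hl i (by simp), hl j (by simp), hl k (by simp), sum3 p hij hik hjk l⟩
  · rintro ⟨a, b, c, ha, hb, hc, rfl⟩
    obtain ⟨l, rfl, rfl, rfl⟩ := exists_fun3 hij hik hjk a b c
    refine ⟨l, ?_, (sum3 p hij hik hjk l).symm⟩
    simp [ha, hb, hc]

lemma tetraS_eq (K : ℝ) (hij : i ≠ j) (hik : i ≠ k) (hjk : j ≠ k) : tetraS K p {i, j, k} ⊆ tetra K (p i) (p j) (p k) := by
  rintro x ⟨l, hl, hs, rfl⟩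
  refine ⟨l i, l j, l k, hl i (by simp), hl j (by simp), hl k (by simp), ?_, sum3 p hij hik hjk l⟩
  rw [Finset.sum_insert (by simp [hij, hik]), Finset.sum_insert (by simp [hjk]), Finset.sum_singleton, ← add_assoc] at hs
  exact hs

lemma wedgeS_eq (hij : i ≠ j) (hik : i ≠ k) (hjk : j ≠ k) : wedgeS p {i, j, k} i = wedge3 (p i) (p j) (p k) := by
  ext x
  constructor
  · rintro ⟨l, hl, rfl⟩
    exact ⟨l i, l j, l k, hl j (by simp) hij.symm, hl k (by simp) hik.symm, sum3 p hij hik hjk l⟩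
  · rintro ⟨a, b, c, hb, hc, rfl⟩
    obtain ⟨l, rfl, rfl, rfl⟩ := exists_fun3 hij hik hjk a b c
    refine ⟨l, ?_, (sum3 p hij hik hjk l).symm⟩
    simp [hb, hc]
end

lemma dt_ne {n : ℕ} (p : Fin n → E3) {i j k : Fin n} (hij : i ≠ j) (hik : i ≠ k) (hjk : j ≠ k)
    (h : LinearIndepOn ℝ p (({i, j, k} : Finset (Fin n)) : Set (Fin n))) : dt (p i) (p j) (p k) ≠ 0 := by
  intro h0
  rw [← linT_det] at h0
  obtain ⟨x, hx, hx0⟩ := (Submodule.ne_bot_iff _).mp (LinearMap.bot_lt_ker_of_det_eq_zero h0).ne'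
  rw [linearIndepOn_finset_iff] at h
  obtain ⟨l, e0, e1, e2⟩ := exists_fun3 hij hik hjk (x 0) (x 1) (x 2)
  have hx' : x 0 • p i + x 1 • p j + x 2 • p k = 0 := hx
  have := h l (by rw [sum3 p hij hik hjk, e0, e1, e2]; exact hx')
  apply hx0
  ext t
  fin_cases t
  · simpa [e0] using this i (by simp)
  · simpa [e1] using this j (by simp)
  · simpa [e2] using this k (by simp)

lemma facet_data {n : ℕ} (p : Fin n → E3) (hp : ∀ i, ‖p i‖ ≤ 1) (c : Fin n → ℝ) (hG : Gen p c)
    (K : ℝ) (hK : 0 ≤ K) (S : Finset (Fin n)) (hS : IsFacet p c S) :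
    MeasurableSet (coneS p S) ∧ (∀ i ∈ S, MeasurableSet (wedgeS p S i)) ∧
    0 < ballM.real (coneS p S) ∧ ballM.real (coneS p S) < ballM.real Set.univ / 2 ∧
    ∑ i ∈ S, ballM.real (wedgeS p S i) = 2 * ballM.real (coneS p S) + ballM.real Set.univ / 2 ∧
    volume (tetraS K p S) ≤ ENNReal.ofReal (K ^ 3 *
      gF (π / 6 + (2 * π / 3) * (ballM.real (coneS p S) / ballM.real Set.univ))) := by
  have hI := hG S (by obtain ⟨_, f, hf, _⟩ := hS; exact ⟨f, hf⟩)
  obtain ⟨i, j, k, hij, hik, hjk, rfl⟩ := Finset.card_eq_three.mp hS.1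
  have hd := dt_ne p hij hik hjk hI
  have c1 : dt (p j) (p k) (p i) = dt (p i) (p j) (p k) := by simp [dt]; ring
  have c2 : dt (p k) (p i) (p j) = dt (p i) (p j) (p k) := by simp [dt]; ring
  have ec := coneS_eq p hij hik hjk
  have w1 := wedgeS_eq p hij hik hjk
  have w2 := wedgeS_eq p hjk hij.symm hik.symm
  have w3 := wedgeS_eq p hik.symm hjk.symm hij
  have s2 : ({j, k, i} : Finset (Fin n)) = {i, j, k} := by ext t; simp; tauto
  have s3 : ({k, i, j} : Finset (Fin n)) = {i, j, k} := by ext t; simp; tauto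
  rw [s2] at w2
  rw [s3] at w3
  obtain ⟨g1, g2⟩ := girard _ _ _ hd
  refine ⟨?_, ?_, ?_, ?_, ?_, ?_⟩
  · rw [ec]; exact (cone3_isOpen _ _ _ hd).measurableSet
  · intro t ht
    simp only [Finset.mem_insert, Finset.mem_singleton] at ht
    rcases ht with rfl | rfl | rfl
    · rw [w1]; exact (wedge3_isOpen _ _ _ hd).measurableSet
    · rw [w2]; exact (wedge3_isOpen _ _ _ (by rwa [c1])).measurableSet
    · rw [w3]; exact (wedge3_isOpen _ _ _ (by rwa [c2])).measurableSet
  · rw [ec]; exact cone3_pos _ _ _ hd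
  · rw [ec]; exact g2
  · rw [Finset.sum_insert (by simp [hij, hik]), Finset.sum_insert (by simp [hjk]), Finset.sum_singleton, ← add_assoc,
      w1, w2, w3, ec]
    exact g1
  · refine (measure_mono (tetraS_eq p K hij hik hjk)).trans ?_
    rw [tetra_vol K hK, ec]
    apply ENNReal.ofReal_le_ofReal
    apply mul_le_mul_of_nonneg_left _ (by positivity)
    exact triangle_bound _ _ _ (hp i) (hp j) (hp k) hd


lemma ae_span {n : ℕ} (p : Fin n → E3) :
    ∀ᵐ x ∂(volume : Measure E3), ∀ F : Finset (Fin n), F.card ≤ 2 → x ∉ Submodule.span ℝ (p '' (F : Set (Fin n))) := by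
  rw [ae_all_iff]
  intro F
  by_cases hF : F.card ≤ 2
  · have : volume (Submodule.span ℝ (p '' (F : Set (Fin n))) : Set E3) = 0 := by
      apply Measure.addHaar_submodule
      intro htop
      have h1 := finrank_span_finset_le_card (R := ℝ) (F.image p)
      have h2 : (F.image p).card ≤ F.card := Finset.card_image_le
      rw [Set.finrank, Finset.coe_image, htop, finrank_top, finrank_euclideanSpace_fin] at h1
      omega
    have h3 : ∀ᵐ x ∂(volume : Measure E3), x ∉ (Submodule.span ℝ (p '' (F : Set (Fin n))) : Set E3) :=
      measure_eq_zero_iff_ae_notMem.mp this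
    filter_upwards [h3] with x hx _
    exact hx
  · filter_upwards with x hx
    exact absurd hx hF

open scoped Pointwise in
lemma cover {n : ℕ} (p : Fin n → E3) (h0 : (0 : E3) ∈ interior (convexHull ℝ (Set.range p)))
    (c : Fin n → ℝ) (lo hi : ℝ) (hlo : 0 < lo) (hc1 : ∀ i, lo ≤ c i) (hc2 : ∀ i, c i ≤ hi) (hG : Gen p c)
    (x : E3) (hx : ∀ F : Finset (Fin n), F.card ≤ 2 → x ∉ Submodule.span ℝ (p '' (F : Set (Fin n)))) :
    ∃ S, IsFacet p c S ∧ x ∈ coneS p S ∧ (x ∈ convexHull ℝ (Set.range p) → x ∈ tetraS (hi / lo) p S) := by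
  have hcp : ∀ i, 0 < c i := fun i => hlo.trans_le (hc1 i)
  set q : Fin n → E3 := fun i => (c i)⁻¹ • p i with hq
  set Q := convexHull ℝ (Set.range q) with hQ
  have hcQ : Convex ℝ Q := convex_convexHull ℝ _
  have hkQ : IsCompact Q := (Set.finite_range q).isCompact_convexHull ℝ
  obtain ⟨w0, hw0, hw1, hw2⟩ := hull_range p 0 (interior_subset h0)
  have hne : Nonempty (Fin n) := by
    by_contra hne
    rw [not_nonempty_iff] at hne
    simp at hw1
  have hhi : 0 < hi := by
    obtain ⟨i⟩ := hne
    exact (hcp i).trans_le (hc2 i)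
  have hW : 0 < ∑ i, w0 i * c i := by
    have : ∑ i, w0 i * lo ≤ ∑ i, w0 i * c i :=
      Finset.sum_le_sum (fun i _ => mul_le_mul_of_nonneg_left (hc1 i) (hw0 i))
    rw [← Finset.sum_mul, hw1] at this
    linarith
  have h0Q : (0 : E3) ∈ Q := by
    refine mem_convexHull_of_exists_fintype (fun i => w0 i * c i / ∑ i, w0 i * c i) q ?_ ?_ (fun i => ⟨i, rfl⟩) ?_
    · intro i
      have := hw0 i
      have := (hcp i).le
      positivity
    · rw [← Finset.sum_div, div_self hW.ne']
    · have : ∀ i, (w0 i * c i / ∑ i, w0 i * c i) • q i = (∑ i, w0 i * c i)⁻¹ • (w0 i • p i) := by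
        intro i
        simp only [hq, smul_smul]
        congr 1
        have := (hcp i).ne'
        field_simp
      simp only [this]
      rw [← Finset.smul_sum, hw2, smul_zero]
  have hsub : hi⁻¹ • convexHull ℝ (Set.range p) ⊆ Q := by
    rw [← convexHull_smul]
    apply convexHull_min _ hcQ
    rintro _ ⟨_, ⟨i, rfl⟩, rfl⟩
    have hqi : q i ∈ Q := subset_convexHull ℝ _ ⟨i, rfl⟩
    have := hcQ h0Q hqi (a := 1 - c i / hi) (b := c i / hi)
      (by rw [sub_nonneg, div_le_one hhi]; exact hc2 i) (div_nonneg (hcp i).le hhi.le) (by ring)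
    convert this using 1
    simp only [hq, smul_smul, smul_zero, zero_add]
    congr 1
    have := (hcp i).ne'
    field_simp
  have h0i : (0 : E3) ∈ interior Q := by
    apply interior_mono hsub
    rw [interior_smul₀ (inv_ne_zero hhi.ne')]
    exact ⟨0, h0, by simp⟩
  have hnhds : Q ∈ nhds (0 : E3) := mem_interior_iff_mem_nhds.mp h0i
  have hx0 : x ≠ 0 := by
    rintro rfl
    exact hx ∅ (by simp) (Submodule.zero_mem _)
  have hgp : 0 < gauge Q x :=
    (gauge_pos (absorbent_nhds_zero hnhds) (NormedSpace.isVonNBounded_of_isBounded _ hkQ.isBounded)).mpr hx0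
  set r := gauge Q x with hr
  set z := r⁻¹ • x with hz
  have hxz : x = r • z := by rw [hz, smul_smul, mul_inv_cancel₀ hgp.ne', one_smul]
  have hgz : gauge Q z = 1 := by
    rw [hz, gauge_smul_of_nonneg (inv_nonneg.mpr hgp.le), smul_eq_mul, inv_mul_cancel₀ hgp.ne']
  have hfr : z ∈ frontier Q := (gauge_eq_one_iff_mem_frontier hcQ hnhds).mp hgz
  have hzQ : z ∈ Q := hkQ.isClosed.frontier_subset hfr
  have hzi : z ∉ interior Q := hfr.2
  obtain ⟨f, hf⟩ := geometric_hahn_banach_open_point hcQ.interior isOpen_interior hzi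
  have hfz : 0 < f z := by simpa using hf 0 h0i
  have hfQ : ∀ y ∈ Q, f y ≤ f z := by
    intro y hy
    have hcl : closure (interior Q) = closure Q :=
      hcQ.closure_interior_eq_closure_of_nonempty_interior ⟨0, h0i⟩
    have hy' : y ∈ closure (interior Q) := by rw [hcl]; exact subset_closure hy
    have : closure (interior Q) ⊆ {y | f y ≤ f z} :=
      closure_minimal (fun y hy => (hf y hy).le) (isClosed_le f.continuous continuous_const)
    exact this hy'
  set g : E3 →ₗ[ℝ] ℝ := (f z)⁻¹ • (f : E3 →ₗ[ℝ] ℝ) with hg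
  have hgz1 : g z = 1 := by
    simp [hg, hfz.ne']
  have hgQ : ∀ y ∈ Q, g y ≤ 1 := by
    intro y hy
    simp only [hg, LinearMap.smul_apply, smul_eq_mul, ContinuousLinearMap.coe_coe]
    rw [inv_mul_le_iff₀ hfz, mul_one]
    exact hfQ y hy
  have hgp' : ∀ i, g (p i) ≤ c i := by
    intro i
    have := hgQ (q i) (subset_convexHull ℝ _ ⟨i, rfl⟩)
    simp only [hq, map_smul, smul_eq_mul] at this
    rwa [inv_mul_le_iff₀ (hcp i), mul_one] at this
  obtain ⟨w, hwn, hws, hwz⟩ := hull_range q z hzQ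
  have htight : ∀ i, w i ≠ 0 → g (p i) = c i := by
    have hs : ∑ i, w i * (1 - g (q i)) = 0 := by
      have := congrArg g hwz
      simp only [map_sum, map_smul, smul_eq_mul, hgz1] at this
      simp only [mul_sub, mul_one, Finset.sum_sub_distrib]
      rw [hws, this, sub_self]
    have hz' := (Finset.sum_eq_zero_iff_of_nonneg (fun i _ =>
      mul_nonneg (hwn i) (sub_nonneg.mpr (hgQ (q i) (subset_convexHull ℝ _ ⟨i, rfl⟩))))).mp hs
    intro i hi
    have := hz' i (Finset.mem_univ i)
    have h1 : 1 - g (q i) = 0 := (mul_eq_zero.mp this).resolve_left hi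
    simp only [hq, map_smul, smul_eq_mul] at h1
    have h2 := (hcp i).ne'
    field_simp at h1
    linarith
  classical
  set F : Finset (Fin n) := Finset.univ.filter (fun i => g (p i) = c i) with hF
  set F' : Finset (Fin n) := Finset.univ.filter (fun i => w i ≠ 0) with hF'
  have hsubF : F' ⊆ F := by
    intro i hi
    simp only [hF', hF, Finset.mem_filter, Finset.mem_univ, true_and] at hi ⊢
    exact htight i hi
  set l : Fin n → ℝ := fun i => r * w i * (c i)⁻¹ with hl
  have hxall : x = ∑ i, l i • p i := by
    rw [hxz, ← hwz, Finset.smul_sum]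
    apply Finset.sum_congr rfl
    intro i _
    simp only [hq, hl, smul_smul, mul_assoc]
  have hl0 : ∀ i, i ∉ F' → l i = 0 := by
    intro i hi
    simp only [hF', Finset.mem_filter, Finset.mem_univ, true_and, not_not] at hi
    simp [hl, hi]
  have hxF' : x = ∑ i ∈ F', l i • p i := by
    rw [hxall]
    symm
    apply Finset.sum_subset (Finset.subset_univ _)
    intro i _ hi
    rw [hl0 i hi, zero_smul]
  have hcF' : 3 ≤ F'.card := by
    by_contra hlt
    apply hx F' (by omega)
    rw [hxF']
    apply Submodule.sum_mem
    intro i hi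
    exact Submodule.smul_mem _ _ (Submodule.subset_span ⟨i, hi, rfl⟩)
  have hind := hG F ⟨g, fun i hi => by simpa [hF] using hi⟩
  have hcF : F.card ≤ 3 := by
    have := LinearIndependent.fintype_card_le_finrank hind
    rw [finrank_euclideanSpace_fin] at this
    simpa using this
  have hFF : F' = F := Finset.eq_of_subset_of_card_le hsubF (by omega)
  rw [hFF] at hxF' hcF'
  have hlp : ∀ i ∈ F, 0 < l i := by
    intro i hi
    rw [← hFF] at hi
    simp only [hF', Finset.mem_filter, Finset.mem_univ, true_and] at hi
    have h1 := lt_of_le_of_ne (hwn i) hi.symm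
    have h2 := hcp i
    simp only [hl]; positivity
  refine ⟨F, ⟨by omega, g, fun i hi => by simpa [hF] using hi, ?_⟩, ⟨l, hlp, hxF'⟩, ?_⟩
  · intro i hi
    simp only [hF, Finset.mem_filter, Finset.mem_univ, true_and] at hi
    exact lt_of_le_of_ne (hgp' i) hi
  · intro hxh
    refine ⟨l, fun i hi => (hlp i hi).le, ?_, hxF'⟩
    obtain ⟨u, hu0, hu1, hu2⟩ := hull_range p x hxh
    have b1 : g x ≤ hi := by
      rw [← hu2]
      simp only [map_sum, map_smul, smul_eq_mul]
      calc ∑ i, u i * g (p i) ≤ ∑ i, u i * hi :=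
            Finset.sum_le_sum (fun i _ => mul_le_mul_of_nonneg_left ((hgp' i).trans (hc2 i)) (hu0 i))
        _ = hi := by rw [← Finset.sum_mul, hu1, one_mul]
    have b2 : (∑ i ∈ F, l i) * lo ≤ g x := by
      rw [hxF', Finset.sum_mul]
      simp only [map_sum, map_smul, smul_eq_mul]
      apply Finset.sum_le_sum
      intro i hi
      have e : g (p i) = c i := by simpa [hF] using hi
      rw [e]
      exact mul_le_mul_of_nonneg_left (hc1 i) (hlp i hi).le
    rw [le_div_iff₀ hlo]
    linarith

lemma main_gen {n : ℕ} (hn : 4 ≤ n) (p : Fin n → E3) (hp : ∀ i, ‖p i‖ ≤ 1)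
    (h0 : (0 : E3) ∈ interior (convexHull ℝ (Set.range p)))
    (c : Fin n → ℝ) (lo hi : ℝ) (hlo : 0 < lo) (hhi : 0 < hi) (hc1 : ∀ i, lo ≤ c i) (hc2 : ∀ i, c i ≤ hi) (hG : Gen p c) :
    volume (convexHull ℝ (Set.range p)) ≤
      ENNReal.ofReal ((hi / lo) ^ 3 * ((2 * (n:ℝ) - 4) * gF ((n / (n - 2)) * (π / 6)))) := by
  classical
  have hK : 0 ≤ hi / lo := by positivity
  set K := hi / lo with hKd
  set s : Finset (Finset (Fin n)) := Finset.univ.filter (fun S => IsFacet p c S) with hs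
  have hmem : ∀ S, S ∈ s ↔ IsFacet p c S := by intro S; simp [hs]
  have hd := fun S (hS : S ∈ s) => facet_data p hp c hG K hK S ((hmem S).mp hS)
  set b := ballM.real Set.univ with hb
  have hcov : ∀ᵐ x ∂(volume : Measure E3), ∃ S ∈ s, x ∈ coneS p S ∧ (x ∈ convexHull ℝ (Set.range p) → x ∈ tetraS K p S) := by
    filter_upwards [ae_span p] with x hx
    obtain ⟨S, h1, h2, h3⟩ := cover p h0 c lo hi hlo hc1 hc2 hG x hx
    exact ⟨S, (hmem S).mpr h1, h2, h3⟩
  have hsum : ∑ S ∈ s, ballM.real (coneS p S) = b := by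
    rw [← measureReal_biUnion_finset]
    · apply measureReal_congr
      have hcov' := ballM_ac.ae_le hcov
      filter_upwards [hcov'] with x hx
      obtain ⟨S, h1, h2, _⟩ := hx
      apply propext
      change x ∈ ⋃ S ∈ s, coneS p S ↔ x ∈ Set.univ
      simp only [Set.mem_univ, iff_true, Set.mem_iUnion]
      exact ⟨S, h1, h2⟩
    · intro S hS T hT hne
      apply Set.disjoint_left.mpr
      intro x h1 h2
      exact cone_disj p c ((hmem S).mp hS) ((hmem T).mp hT) hne h1 h2
    · intro S hS; exact (hd S hS).1
  have hs0 : s.Nonempty := by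
    obtain ⟨x, S, hS, _⟩ := hcov.exists
    exact ⟨S, hS⟩
  have hbpos : 0 < b := by
    obtain ⟨S, hS⟩ := hs0
    have h1 := (hd S hS).2.2.1
    have h2 := (hd S hS).2.2.2.1
    linarith
  have hwed : ∑ S ∈ s, ∑ i ∈ S, ballM.real (wedgeS p S i) ≤ n * b := by
    rw [Finset.sum_comm' (t' := Finset.univ) (s' := fun i => s.filter (fun S => i ∈ S)) (by simp)]
    calc ∑ i, ∑ S ∈ s.filter (fun S => i ∈ S), ballM.real (wedgeS p S i) ≤ ∑ i : Fin n, b := by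
          apply Finset.sum_le_sum
          intro i _
          rw [← measureReal_biUnion_finset]
          · exact measureReal_mono (Set.subset_univ _) (measure_ne_top _ _)
          · intro S hS T hT hne
            simp only [Finset.coe_filter, Set.mem_ofPred_eq] at hS hT
            apply Set.disjoint_left.mpr
            intro x h1 h2
            exact wedge_disj p c ((hmem S).mp hS.1) ((hmem T).mp hT.1) hne i hS.2 hT.2 h1 h2
          · intro S hS
            simp only [Finset.mem_filter] at hS
            exact (hd S hS.1).2.1 i hS.2
      _ = n * b := by simp
  rw [Finset.sum_congr rfl (fun S hS => (hd S hS).2.2.2.2.1), Finset.sum_add_distrib, ← Finset.mul_sum, hsum,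
    Finset.sum_const, nsmul_eq_mul] at hwed
  have hcard : (s.card : ℝ) ≤ 2 * n - 4 := by
    by_contra hlt
    push Not at hlt
    nlinarith [mul_lt_mul_of_pos_right hlt hbpos]
  have hJ := gF_jensen s (fun S => ballM.real (coneS p S)) b n hn hbpos
    (fun S hS => ⟨(hd S hS).2.2.1, (hd S hS).2.2.2.1⟩) hsum hcard
  have hgn : ∀ S ∈ s, 0 ≤ K ^ 3 * gF (π / 6 + (2 * π / 3) * (ballM.real (coneS p S) / b)) := by
    intro S hS
    have hI := hG S (by obtain ⟨_, f, hf, _⟩ := (hmem S).mp hS; exact ⟨f, hf⟩)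
    have hfac := (hmem S).mp hS
    obtain ⟨i, j, k, hij, hik, hjk, rfl⟩ := Finset.card_eq_three.mp hfac.1
    have hdt := dt_ne p hij hik hjk hI
    have := triangle_bound _ _ _ (hp i) (hp j) (hp k) hdt
    rw [← coneS_eq p hij hik hjk] at this
    apply mul_nonneg (by positivity)
    exact le_trans (by positivity) this
  calc volume (convexHull ℝ (Set.range p)) ≤ volume (⋃ S ∈ s, tetraS K p S) := by
        apply measure_mono_ae
        filter_upwards [hcov] with x hx hxh
        obtain ⟨S, h1, _, h3⟩ := hx
        change x ∈ ⋃ S ∈ s, tetraS K p S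
        simp only [Set.mem_iUnion]
        exact ⟨S, h1, h3 hxh⟩
    _ ≤ ∑ S ∈ s, volume (tetraS K p S) := measure_biUnion_finset_le _ _
    _ ≤ ∑ S ∈ s, ENNReal.ofReal (K ^ 3 * gF (π / 6 + (2 * π / 3) * (ballM.real (coneS p S) / b))) :=
        Finset.sum_le_sum (fun S hS => (hd S hS).2.2.2.2.2)
    _ = ENNReal.ofReal (∑ S ∈ s, K ^ 3 * gF (π / 6 + (2 * π / 3) * (ballM.real (coneS p S) / b))) :=
        (ENNReal.ofReal_sum_of_nonneg hgn).symm
    _ ≤ _ := by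
        apply ENNReal.ofReal_le_ofReal
        rw [← Finset.mul_sum]
        exact mul_le_mul_of_nonneg_left hJ (by positivity)


lemma gen_finite {n : ℕ} (p : Fin n → E3) : {t : ℝ | ¬ Gen p (fun i => t ^ (i : ℕ))}.Finite := by
  classical
  have hrel : ∀ F : Finset (Fin n), ∃ P : Polynomial ℝ, P ≠ 0 ∧ ∀ t : ℝ,
      (∃ f : E3 →ₗ[ℝ] ℝ, ∀ i ∈ F, f (p i) = t ^ (i : ℕ)) → ¬ LinearIndepOn ℝ p (F : Set (Fin n)) → P.IsRoot t := by
    intro F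
    by_cases hF : LinearIndepOn ℝ p (F : Set (Fin n))
    · exact ⟨1, one_ne_zero, fun t _ h => absurd hF h⟩
    · have hF' := hF
      rw [linearIndepOn_finset_iff] at hF'
      push Not at hF'
      obtain ⟨m, hm, i, hi, hmi⟩ := hF'
      refine ⟨∑ j ∈ F, Polynomial.C (m j) * Polynomial.X ^ (j : ℕ), ?_, ?_⟩
      · intro h
        have := congrArg (fun P => Polynomial.coeff P (i : ℕ)) h
        simp only [Polynomial.finset_sum_coeff, Polynomial.coeff_C_mul_X_pow, Polynomial.coeff_zero] at this
        rw [Finset.sum_eq_single i] at this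
        · simp at this; exact hmi this
        · intro j _ hj
          rw [if_neg]
          intro he; exact hj (Fin.ext he.symm)
        · intro h; exact absurd hi h
      · rintro t ⟨f, hf⟩ _
        have := congrArg f hm
        simp only [map_sum, map_smul, smul_eq_mul, map_zero] at this
        rw [Polynomial.IsRoot, Polynomial.eval_finset_sum, ← this]
        apply Finset.sum_congr rfl
        intro j hj
        simp [hf j hj]
  choose P hP0 hP using hrel
  apply Set.Finite.subset (s := ⋃ F : Finset (Fin n), {t | (P F).IsRoot t})
  · exact Set.finite_iUnion (fun F => Polynomial.finite_setOf_isRoot (hP0 F))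
  · intro t ht
    simp only [Set.mem_ofPred_eq, Gen] at ht
    push Not at ht
    obtain ⟨F, h1, h2⟩ := ht
    exact Set.mem_iUnion.mpr ⟨F, hP F t h1 h2⟩

lemma main_unit {n : ℕ} (hn : 4 ≤ n) (p : Fin n → E3) (hp : ∀ i, ‖p i‖ ≤ 1)
    (h0 : (0 : E3) ∈ interior (convexHull ℝ (Set.range p))) :
    volume (convexHull ℝ (Set.range p)) ≤
      ENNReal.ofReal ((2 * (n:ℝ) - 4) * gF ((n / (n - 2)) * (π / 6))) := by
  set B := (2 * (n:ℝ) - 4) * gF ((n / (n - 2)) * (π / 6))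
  have hfin := gen_finite p
  have hev : ∀ᶠ t in nhdsWithin (1:ℝ) (Set.Iio 1), volume (convexHull ℝ (Set.range p)) ≤
      ENNReal.ofReal ((1 / t ^ n) ^ 3 * B) := by
    have e1 : ∀ᶠ t in nhdsWithin (1:ℝ) (Set.Iio 1), t ∈ Set.Ioo (0:ℝ) 1 := Ioo_mem_nhdsLT (by norm_num)
    have e2 : ∀ᶠ t in nhdsWithin (1:ℝ) (Set.Iio 1), Gen p (fun i => t ^ (i : ℕ)) := by
      have hf2 : ({t : ℝ | ¬ Gen p (fun i => t ^ (i : ℕ))} \ {1}).Finite := hfin.subset Set.diff_subset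
      have hn1 : ({t : ℝ | ¬ Gen p (fun i => t ^ (i : ℕ))} \ {1})ᶜ ∈ nhds (1:ℝ) :=
        hf2.isClosed.isOpen_compl.mem_nhds (by simp)
      filter_upwards [mem_nhdsWithin_of_mem_nhds hn1, self_mem_nhdsWithin] with t ht ht1
      by_contra hG
      exact ht ⟨hG, by simpa using (ne_of_lt ht1)⟩
    filter_upwards [e1, e2] with t ht hG
    have hpos : 0 < t ^ n := pow_pos ht.1 n
    exact main_gen hn p hp h0 (fun i => t ^ (i : ℕ)) (t ^ n) 1 hpos one_pos
      (fun i => pow_le_pow_of_le_one ht.1.le ht.2.le i.2.le) (fun i => pow_le_one₀ ht.1.le ht.2.le) hG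
  have hlim : Filter.Tendsto (fun t : ℝ => ENNReal.ofReal ((1 / t ^ n) ^ 3 * B)) (nhdsWithin (1:ℝ) (Set.Iio 1))
      (nhds (ENNReal.ofReal B)) := by
    have hc : ContinuousAt (fun t : ℝ => ENNReal.ofReal ((1 / t ^ n) ^ 3 * B)) 1 := by
      apply ENNReal.continuous_ofReal.continuousAt.comp
      have : ContinuousAt (fun t : ℝ => 1 / t ^ n) 1 :=
        ContinuousAt.div continuousAt_const (by fun_prop) (by simp)
      exact (this.pow 3).mul continuousAt_const
    have h1 := hc.tendsto
    simp only [one_pow, div_one, one_mul] at h1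
    exact h1.mono_left nhdsWithin_le_nhds
  exact ge_of_tendsto hlim hev

open scoped Pointwise in
lemma main_ball {n : ℕ} (hn : 4 ≤ n) (p : Fin n → E3) (q : E3) (ρ : ℝ) (hρ : 0 < ρ)
    (hp : ∀ i, p i ∈ Metric.closedBall q ρ)
    (h0 : q ∈ interior (convexHull ℝ (Set.range p))) :
    (volume (convexHull ℝ (Set.range p))).toReal ≤
      ρ ^ 3 * ((2 * (n:ℝ) - 4) * gF ((n / (n - 2)) * (π / 6))) := by
  have hB : 0 ≤ (2 * (n:ℝ) - 4) * gF ((n / (n - 2)) * (π / 6)) := by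
    have h1 := gF_omega_nonneg n hn
    have h2 : (4:ℝ) ≤ n := by exact_mod_cast hn
    exact mul_nonneg (by linarith) h1
  set p' : Fin n → E3 := fun i => ρ⁻¹ • (-q +ᵥ p i) with hp'
  have hr : Set.range p' = ρ⁻¹ • (-q +ᵥ Set.range p) := by
    ext x
    constructor
    · rintro ⟨i, rfl⟩
      exact Set.smul_mem_smul_set (Set.vadd_mem_vadd_set ⟨i, rfl⟩)
    · rintro ⟨_, ⟨_, ⟨i, rfl⟩, rfl⟩, rfl⟩
      exact ⟨i, rfl⟩
  have hh : convexHull ℝ (Set.range p') = ρ⁻¹ • (-q +ᵥ convexHull ℝ (Set.range p)) := by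
    rw [hr, convexHull_smul, convexHull_vadd]
  have hm := main_unit hn p' (by
      intro i
      have := hp i
      rw [mem_closedBall_iff_norm] at this
      simp only [hp', norm_smul, norm_inv, Real.norm_of_nonneg hρ.le]
      rw [inv_mul_le_iff₀ hρ, mul_one, vadd_eq_add, neg_add_eq_sub]
      exact this) (by
      rw [hh, interior_smul₀ (inv_ne_zero hρ.ne'), interior_vadd]
      exact ⟨0, ⟨q, h0, by simp⟩, by simp⟩)
  rw [hh, Measure.addHaar_smul, measure_vadd, finrank_euclideanSpace_fin] at hm
  have := ENNReal.toReal_mono ENNReal.ofReal_ne_top hm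
  rw [ENNReal.toReal_mul, ENNReal.toReal_ofReal (abs_nonneg _), ENNReal.toReal_ofReal hB,
    abs_of_pos (by positivity), inv_pow, inv_mul_le_iff₀ (by positivity)] at this
  exact this

lemma final_bound {n : ℕ} (hn : 4 ≤ n) (R : ℝ) (hR : 0 < R) (c : E3) (p : Fin n → E3)
    (hp : ∀ i, p i ∈ Metric.closedBall c R) :
    (volume (convexHull ℝ (Set.range p))).toReal ≤
      R ^ 3 * ((2 * (n:ℝ) - 4) * gF ((n / (n - 2)) * (π / 6))) := by
  have hB : 0 ≤ (2 * (n:ℝ) - 4) * gF ((n / (n - 2)) * (π / 6)) := by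
    have h1 := gF_omega_nonneg n hn
    have h2 : (4:ℝ) ≤ n := by exact_mod_cast hn
    exact mul_nonneg (by linarith) h1
  set B := (2 * (n:ℝ) - 4) * gF ((n / (n - 2)) * (π / 6))
  set P := convexHull ℝ (Set.range p) with hPd
  have hcP : Convex ℝ P := convex_convexHull ℝ _
  have hkP : IsCompact P := (Set.finite_range p).isCompact_convexHull ℝ
  have hpP : ∀ i, p i ∈ P := fun i => subset_convexHull ℝ _ ⟨i, rfl⟩
  by_cases hv : volume P = 0
  · rw [hv, ENNReal.toReal_zero]; positivity
  have hinter : (interior P).Nonempty := by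
    by_contra hne
    rw [Set.not_nonempty_iff_eq_empty] at hne
    apply hv
    have h1 := hcP.addHaar_frontier volume
    rwa [frontier, hne, Set.diff_empty, hkP.isClosed.closure_eq] at h1
  obtain ⟨z, hz⟩ := hinter
  obtain ⟨q, hqP, hq⟩ := exists_norm_eq_iInf_of_complete_convex ⟨z, interior_subset hz⟩ hkP.isComplete hcP c
  rw [norm_eq_iInf_iff_real_inner_le_zero hcP hqP] at hq
  have hpq : ∀ i, ‖p i - q‖ ≤ R := by
    intro i
    have h1 := hq (p i) (hpP i)
    have h2 := hp i
    rw [mem_closedBall_iff_norm] at h2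
    have h3 : ‖p i - c‖ ^ 2 = ‖p i - q‖ ^ 2 - 2 * inner ℝ (c - q) (p i - q) + ‖c - q‖ ^ 2 := by
      rw [show p i - c = (p i - q) - (c - q) by abel, norm_sub_sq_real, real_inner_comm]
    have h4 : ‖p i - q‖ ^ 2 ≤ R ^ 2 := by
      have := pow_le_pow_left₀ (norm_nonneg _) h2 2
      nlinarith [sq_nonneg ‖c - q‖]
    exact (pow_le_pow_iff_left₀ (norm_nonneg _) hR.le (by norm_num)).mp h4
  have hev : ∀ᶠ h in nhdsWithin (0:ℝ) (Set.Ioi 0), (volume P).toReal ≤ (R + h * ‖z - q‖) ^ 3 * B := by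
    have e1 : ∀ᶠ h in nhdsWithin (0:ℝ) (Set.Ioi 0), h ∈ Set.Ioo (0:ℝ) 1 := Ioo_mem_nhdsGT (by norm_num)
    filter_upwards [e1] with h hh
    have hnn : 0 ≤ h * ‖z - q‖ := mul_nonneg hh.1.le (norm_nonneg _)
    apply main_ball hn p (q + h • (z - q)) _ (by linarith)
    · intro i
      rw [mem_closedBall_iff_norm]
      calc ‖p i - (q + h • (z - q))‖ = ‖(p i - q) - h • (z - q)‖ := by congr 1; abel
        _ ≤ ‖p i - q‖ + ‖h • (z - q)‖ := norm_sub_le _ _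
        _ ≤ R + h * ‖z - q‖ := by
          rw [norm_smul, Real.norm_of_nonneg hh.1.le]
          linarith [hpq i]
    · exact hcP.add_smul_sub_mem_interior hqP hz ⟨hh.1, hh.2.le⟩
  have hlim : Filter.Tendsto (fun h : ℝ => (R + h * ‖z - q‖) ^ 3 * B) (nhdsWithin (0:ℝ) (Set.Ioi 0))
      (nhds (R ^ 3 * B)) := by
    have hc : Continuous (fun h : ℝ => (R + h * ‖z - q‖) ^ 3 * B) := by fun_prop
    have h1 := hc.tendsto 0
    simp only [zero_mul, add_zero] at h1
    exact h1.mono_left nhdsWithin_le_nhds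
  exact ge_of_tendsto hlim hev

theorem fejes_toth_circumradius_bound (d n : ℕ) (hd : 3 ≤ d) (hn : 4 ≤ n)
    (R : ℝ) (hR : 0 < R) (c : EuclideanSpace ℝ (Fin 3))
    (p : Fin n → EuclideanSpace ℝ (Fin 3))
    (hp : ∀ i, p i ∈ Metric.closedBall c R) :
    (volume (convexHull ℝ (Set.range p))).toReal ≤
      (1 / 6) * ((n : ℝ) - 2) * Real.cot (((n : ℝ) / ((n : ℝ) - 2)) * (π / 6)) *
        (3 - (Real.cot (((n : ℝ) / ((n : ℝ) - 2)) * (π / 6))) ^ 2) * R ^ 3 := by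
  refine (final_bound hn R hR c p hp).trans (le_of_eq ?_)
  unfold gF
  ring
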